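/- arXiv:math/0301194 — 2 statements merged into one kernel-verified Lean document; each statement's English description precedes it below -/
import Mathlib

section
/- Let t, L, K ≥ 1, Δ ≥ 1, Δ1 ≥ 0, Δ2 ≥ 1 and m ≥ 4L+2 be integers. Let G_1,…,G_K ∈ ℚ[Z_1,…,Z_L] have total degree at most Δ1, let D ⊆ ℂ^L belong to the Boolean algebra generated by the zero sets {c : G_i(c) = 0}, let (Ω_α)_{|α|≤Δ} be polynomials in ℚ[Z_1,…,Z_L] of total degree at most Δ2 indexed by exponent vectors α ∈ ℕ^t with |α| ≤ Δ, set Q_c := Σ_{|α|≤Δ} Ω_α(c)·Y^α, let O := {Q_c : c ∈ D}, and assume that O is a cone (λ·F ∈ O for every λ ∈ ℂ and F ∈ O). Let Ō be the Zariski closure of O in the coefficient space of polynomials of total degree at most Δ in Y_1,…,Y_t. Let M ⊆ ℚ be finite with #M ≥ 2 and #M ≥ Δ²·(L+1)^{1/L}·(1+K·Δ1)·Δ2. Then there exists γ = (γ_1,…,γ_m) ∈ (M^t)^m such that the evaluation map σ_γ : Ō → ℂ^m defined by σ_γ(F) := (F(γ_1),…,F(γ_m)) is injective, is the restriction to Ō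 of a ℂ-linear map, has image σ_γ(Ō) a Zariski closed cone of ℂ^m, and maps every set of the form Ō ∩ C with C Zariski closed onto a Zariski closed subset of ℂ^m (so σ_γ is a homeomorphism of Ō onto σ_γ(Ō) for the Zariski topologies); moreover the number of tuples γ ∈ (M^t)^m for which σ_γ fails to be injective on Ō is at most (#M)^{mt−1}. -/
open scoped BigOperators

/-- A subset of `ℂ^ι` is Zariski closed if it is the common zero set of a family
of polynomials with complex coefficients. -/
def ZariskiClosed {ι : Type} (S : Set (ι → ℂ)) : Prop :=
  ∃ F : Set (MvPolynomial ι ℂ), S = {x : ι → ℂ | ∀ f ∈ F, MvPolynomial.eval x f = 0}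

/-- The Zariski closure of a set: the intersection of all Zariski closed sets
containing it. -/
def zClosure {ι : Type} (S : Set (ι → ℂ)) : Set (ι → ℂ) :=
  ⋂₀ {C : Set (ι → ℂ) | ZariskiClosed C ∧ S ⊆ C}

/-- Membership in the Boolean algebra of sets generated by a family `G`. -/
inductive InBoolAlg {α : Type*} (G : Set (Set α)) : Set α → Prop
  | basic (s : Set α) : s ∈ G → InBoolAlg G s
  | univ : InBoolAlg G Set.univ
  | compl (s : Set α) : InBoolAlg G s → InBoolAlg G sᶜ
  | inter (s u : Set α) : InBoolAlg G s → InBoolAlg G u → InBoolAlg G (s ∩ u)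

/-- Evaluation of a coefficient vector (indexed by exponent vectors
`α : Fin t → Fin (Δ+1)`) at a point `y ∈ ℂ^t`: the value of the corresponding
polynomial `Σ_α v_α · y^α`. -/
noncomputable def evalVec {t Δ : ℕ} (v : (Fin t → Fin (Δ + 1)) → ℂ) (y : Fin t → ℂ) : ℂ :=
  ∑ α : Fin t → Fin (Δ + 1), v α * ∏ i : Fin t, y i ^ (α i : ℕ)

/-- The object class `O = {Q_c : c ∈ D}`, where `Q_c` is the coefficient vector
`α ↦ Ω_α(c)`. -/
def objClass (t L Δ : ℕ) (D : Set (Fin L → ℂ))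
    (Ω : (Fin t → Fin (Δ + 1)) → MvPolynomial (Fin L) ℚ) :
    Set ((Fin t → Fin (Δ + 1)) → ℂ) :=
  {v | ∃ c ∈ D, v = fun α => MvPolynomial.aeval c (Ω α)}

/-- A subset of a complex vector space is a cone if it is closed under
multiplication by all complex scalars. -/
def IsCone {ι : Type} (S : Set (ι → ℂ)) : Prop :=
  ∀ c : ℂ, ∀ v ∈ S, c • v ∈ S

section
open MvPolynomial
open scoped ENNReal
lemma trdeg_hyper (k : Type) [Field k] (s : ℕ) (g : MvPolynomial (Fin s) k) (hg : Prime g) :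
    Algebra.trdeg k (MvPolynomial (Fin s) k ⧸ Ideal.span {g}) + 1 = s := by
  classical
  set p := Ideal.span {g} with hp
  have hpp : p.IsPrime := (Ideal.span_singleton_prime hg.ne_zero).2 hg
  set A := MvPolynomial (Fin s) k ⧸ p
  let x : Fin s → A := fun i => Ideal.Quotient.mk p (X i)
  have hx : ∀ q : MvPolynomial (Fin s) k, aeval x q = Ideal.Quotient.mk p q := by
    intro q
    have : aeval x = Ideal.Quotient.mkₐ k p := by
      ext i; simp only [aeval_X]; rfl
    rw [this]; rfl
  have hadj : Algebra.adjoin k (Set.range x) = ⊤ := by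
    rw [Algebra.adjoin_range_eq_range_aeval, AlgHom.range_eq_top]
    intro a
    obtain ⟨q, rfl⟩ := Ideal.Quotient.mk_surjective a
    exact ⟨q, hx q⟩
  -- upper bound
  have halg : Algebra.IsAlgebraic (Algebra.adjoin k (Set.range x)) A := by
    rw [hadj]
    refine ⟨fun a => ?_⟩
    exact isAlgebraic_algebraMap (⟨a, trivial⟩ : (⊤ : Subalgebra k A))
  have hup : Algebra.trdeg k A < s := by
    by_contra hcon
    push Not at hcon
    have hb := Algebra.IsAlgebraic.isTranscendenceBasis_of_le_trdeg_of_finite k x (by simpa using hcon)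
    have := hb.1 
    rw [algebraicIndependent_iff] at this
    refine hg.ne_zero (this g ?_)
    rw [hx, Ideal.Quotient.eq_zero_iff_mem]
    exact Ideal.mem_span_singleton_self g
  -- lower bound
  have hvar : ∃ i, g.degreeOf i ≠ 0 := by
    by_contra hcon
    push Not at hcon
    have h0 : g = C (coeff 0 g) := by
      ext m
      rw [coeff_C]
      split_ifs with h
      · rw [h]
      · by_contra hne
        apply h
        ext i
        have := hcon i
        rw [degreeOf_eq_sup] at this
        have h2 := Finset.le_sup (f := fun m : Fin s →₀ ℕ => m i) (mem_support_iff.2 hne)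
        simp only [this] at h2
        simp at h2 ⊢
        omega
    refine hg.not_isUnit ?_
    rw [h0]
    refine (IsUnit.mk0 _ ?_).map C
    intro h
    rw [h, C_0] at h0
    exact hg.ne_zero h0
  obtain ⟨i, hi⟩ := hvar
  let y : {j : Fin s // j ≠ i} → A := fun j => x j
  have hy : AlgebraicIndependent k y := by
    rw [algebraicIndependent_iff]
    intro q hq
    have h1 : aeval y q = aeval x (rename Subtype.val q) := by
      rw [aeval_rename]; rfl
    rw [h1, hx, Ideal.Quotient.eq_zero_iff_mem, hp, Ideal.mem_span_singleton] at hq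
    obtain ⟨r, hr⟩ := hq
    by_contra hq0
    have hne : rename Subtype.val q ≠ 0 := by
      intro h
      exact hq0 ((rename_injective _ Subtype.val_injective) (by simpa using h))
    have hr0 : r ≠ 0 := by rintro rfl; simp at hr; exact hne (by simpa using hr)
    have hd : degreeOf i (rename (Subtype.val : {j : Fin s // j ≠ i} → Fin s) q) = 0 := by
      rw [degreeOf_eq_sup]
      apply Nat.le_zero.1
      refine Finset.sup_le fun m hm => ?_
      rw [support_rename_of_injective Subtype.val_injective, Finset.mem_image] at hm
      obtain ⟨m', _, rfl⟩ := hm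
      refine le_of_eq (Finsupp.mapDomain_of_notMem_range _ _ ?_)
      rintro ⟨j, hj⟩
      exact j.2 hj
    rw [hr, degreeOf_mul_eq hg.ne_zero hr0] at hd
    omega
  have hlow := hy.cardinalMk_le_trdeg
  have hcard : (Cardinal.mk {j : Fin s // j ≠ i}) = ((s - 1 : ℕ) : Cardinal) := by
    rw [Cardinal.mk_fintype]
    simp [Fintype.card_subtype_compl]
  rw [hcard] at hlow
  obtain ⟨n, hn⟩ := Cardinal.lt_aleph0.1 (hup.trans (Cardinal.natCast_lt_aleph0))
  rw [hn] at hlow hup ⊢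
  have h1 : s - 1 ≤ n := by exact_mod_cast hlow
  have h2 : n < s := by exact_mod_cast hup
  have : n + 1 = s := by omega
  exact_mod_cast this

lemma trdeg_quot_height_one (k : Type) [Field k] (B : Type) [CommRing B] [IsDomain B] [Algebra k B]
    [Algebra.FiniteType k B] (q : Ideal B) [hq : q.IsPrime] (hq0 : q ≠ ⊥) (hh : q.height ≤ 1) :
    Algebra.trdeg k (B ⧸ q) + 1 = Algebra.trdeg k B := by
  obtain ⟨s, φ, hinj, hint⟩ := exists_integral_inj_algHom_of_fg k B
  letI : Algebra (MvPolynomial (Fin s) k) B := φ.toRingHom.toAlgebra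
  haveI : IsScalarTower k (MvPolynomial (Fin s) k) B := IsScalarTower.of_algebraMap_eq fun x => by
    exact (φ.commutes x).symm
  haveI : Algebra.IsIntegral (MvPolynomial (Fin s) k) B := ⟨hint⟩
  haveI : FaithfulSMul (MvPolynomial (Fin s) k) B :=
    (faithfulSMul_iff_algebraMap_injective _ _).2 hinj
  haveI : IsDomain (B ⧸ q) := Ideal.Quotient.isDomain q
  set p := q.under (MvPolynomial (Fin s) k) with hp
  haveI : q.LiesOver p := ⟨rfl⟩
  haveI hpp : p.IsPrime := Ideal.IsPrime.under _ q
  have hp0 : p ≠ ⊥ := by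
    obtain ⟨b, hb, hb0⟩ := Submodule.exists_mem_ne_zero_of_ne_bot hq0
    exact Ideal.comap_ne_bot_of_integral_mem hb0 hb (Algebra.IsIntegral.isIntegral b)
  obtain ⟨g, hg, hgp⟩ := hpp.exists_mem_prime_of_ne_bot hp0
  have hpg : p = Ideal.span {g} := by
    by_contra hne
    haveI hgpr : (Ideal.span {g}).IsPrime := (Ideal.span_singleton_prime hgp.ne_zero).2 hgp
    have hlt : Ideal.span {g} < p :=
      lt_of_le_of_ne ((Ideal.span_singleton_le_iff_mem _).2 hg) (Ne.symm hne)
    obtain ⟨P, hPq, hPp, hPl⟩ := Ideal.exists_ideal_lt_liesOver_of_lt q hlt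
    have h1 := (Ideal.height_le_iff (n := 1)).1 (by simpa using hh) P hPp hPq
    have h2 : P.height = 0 := by
      simpa using h1
    haveI := hPp
    rw [Ideal.height_eq_zero_iff_eq_bot] at h2
    have h3 : Ideal.span {g} = ⊥ := by
      rw [hPl.over, h2]
      exact Ideal.under_bot _ _
    exact hgp.ne_zero (by simpa using h3)
  have e1 : Algebra.trdeg k B = s := by
    rw [← trdeg_add_eq k (MvPolynomial (Fin s) k), MvPolynomial.trdeg_of_isDomain,
      trdeg_eq_zero]
    simp
  have e2 : Algebra.trdeg k (B ⧸ q) = Algebra.trdeg k (MvPolynomial (Fin s) k ⧸ p) := by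
    rw [← trdeg_add_eq k (MvPolynomial (Fin s) k ⧸ p), 
      trdeg_eq_zero (R := MvPolynomial (Fin s) k ⧸ p)]
    simp
  rw [e1, e2, hpg, trdeg_hyper k s g hgp]

noncomputable def pdim {σ : Type} (P : Ideal (MvPolynomial σ ℂ)) : ℕ :=
  (Algebra.trdeg ℂ (MvPolynomial σ ℂ ⧸ P)).toNat

lemma trdeg_fin {σ : Type} [Finite σ] (P : Ideal (MvPolynomial σ ℂ)) :
    Algebra.trdeg ℂ (MvPolynomial σ ℂ ⧸ P) = (pdim P : Cardinal) := by
  rw [pdim, Cardinal.cast_toNat_of_lt_aleph0]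
  exact trdeg_lt_aleph0_of_finiteType

lemma pdim_cut {σ : Type} [Finite σ] (P : Ideal (MvPolynomial σ ℂ)) [hP : P.IsPrime]
    (f : MvPolynomial σ ℂ) (hf : f ∉ P) (Q : Ideal (MvPolynomial σ ℂ))
    (hQ : Q ∈ (P ⊔ Ideal.span {f}).minimalPrimes) : pdim Q + 1 = pdim P := by
  have hPQ : P ≤ Q := le_sup_left.trans hQ.1.2
  have hfQ : f ∈ Q := hQ.1.2 (le_sup_right (a := P) (Ideal.mem_span_singleton_self f))
  haveI := hQ.1.1
  set q := Q.map (Ideal.Quotient.mk P) with hq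
  have hh : q.height ≤ 1 := Ideal.map_height_le_one_of_mem_minimalPrimes hQ
  haveI : q.IsPrime := by
    apply Ideal.map_isPrime_of_surjective Ideal.Quotient.mk_surjective
    simpa using hPQ
  have hq0 : q ≠ ⊥ := by
    intro h
    apply hf
    rw [← Ideal.Quotient.eq_zero_iff_mem]
    have : Ideal.Quotient.mk P f ∈ q := Ideal.mem_map_of_mem _ hfQ
    rw [h] at this
    simpa using this
  have key := trdeg_quot_height_one ℂ (MvPolynomial σ ℂ ⧸ P) q hq0 hh
  have e : ((MvPolynomial σ ℂ ⧸ P) ⧸ q) ≃ₐ[ℂ] MvPolynomial σ ℂ ⧸ Q :=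
    DoubleQuot.quotQuotEquivQuotOfLEₐ ℂ hPQ
  rw [e.trdeg_eq, trdeg_fin, trdeg_fin] at key
  exact_mod_cast key

lemma tsum_geom_fin (n : ℕ) (z : ℝ≥0∞) :
    ∑' β : Fin n → ℕ, z ^ (∑ i, β i) = ((1 - z)⁻¹) ^ n := by
  induction n with
  | zero => simp [tsum_fintype]
  | succ n ih =>
    rw [← (Fin.consEquiv (fun _ : Fin (n+1) => ℕ)).tsum_eq]
    rw [ENNReal.tsum_prod']
    simp only [Fin.consEquiv, Equiv.coe_fn_mk, Fin.sum_univ_succ, Fin.cons_zero, Fin.cons_succ, pow_add]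
    simp_rw [ENNReal.tsum_mul_left, ih, ENNReal.tsum_mul_right, ENNReal.tsum_geometric]
    ring

lemma tsum_geom_finsupp (σ : Type) [Fintype σ] (z : ℝ≥0∞) :
    ∑' β : σ →₀ ℕ, z ^ β.degree = ((1 - z)⁻¹) ^ (Fintype.card σ) := by
  rw [← tsum_geom_fin]
  rw [← (Finsupp.equivFunOnFinite.trans
    (Equiv.arrowCongr (Fintype.equivFin σ) (Equiv.refl ℕ)) : (σ →₀ ℕ) ≃ _).tsum_eq]
  refine tsum_congr fun β => ?_
  congr 1
  rw [Finsupp.degree_eq_sum]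
  symm
  simp only [Equiv.trans_apply, Equiv.arrowCongr_apply, Equiv.coe_refl, Function.comp, id]
  exact (Fintype.equivFin σ).symm.sum_comp (fun i => β i)

noncomputable def KF {σ : Type} (P : Ideal (MvPolynomial σ ℂ)) (z : ℝ≥0∞) : ℝ≥0∞ :=
  ⨆ (r : ℕ) (a : Fin r → MvPolynomial σ ℂ)
    (_ : LinearIndependent ℂ (fun i => Ideal.Quotient.mk P (a i))), ∑ i, z ^ (a i).totalDegree

lemma sum_le_KF {σ : Type} (P : Ideal (MvPolynomial σ ℂ)) (z : ℝ≥0∞) {ι : Type} [Fintype ι]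
    (a : ι → MvPolynomial σ ℂ) (h : LinearIndependent ℂ (fun i => Ideal.Quotient.mk P (a i))) :
    ∑ i, z ^ (a i).totalDegree ≤ KF P z := by
  rw [← (Fintype.equivFin ι).symm.sum_comp]
  unfold KF
  refine le_iSup_of_le (Fintype.card ι) (le_iSup_of_le (fun i => a ((Fintype.equivFin ι).symm i)) 
    (le_iSup_of_le ?_ le_rfl))
  exact h.comp _ (Fintype.equivFin ι).symm.injective

lemma tsum_le_KF {σ : Type} (P : Ideal (MvPolynomial σ ℂ)) (z : ℝ≥0∞) {ι : Type}
    (a : ι → MvPolynomial σ ℂ) (h : LinearIndependent ℂ (fun i => Ideal.Quotient.mk P (a i))) :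
    ∑' i, z ^ (a i).totalDegree ≤ KF P z := by
  rw [ENNReal.tsum_eq_iSup_sum]
  refine iSup_le fun s => ?_
  rw [← Finset.sum_coe_sort]
  exact sum_le_KF P z (fun i : s => a i) (h.comp _ Subtype.val_injective)

lemma indep_lift {σ : Type} (P : Ideal (MvPolynomial σ ℂ)) {ι : Type} 
    (a : ι → MvPolynomial σ ℂ) (h : LinearIndependent ℂ (fun i => Ideal.Quotient.mk P (a i))) :
    LinearIndependent ℂ a :=
  LinearIndependent.of_comp (Ideal.Quotient.mkₐ ℂ P).toLinearMap h

lemma KF_le {σ : Type} [Fintype σ] (P : Ideal (MvPolynomial σ ℂ)) (z : ℝ≥0∞) (hz : z ≤ 1) :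
    KF P z ≤ ((1 - z)⁻¹) ^ (Fintype.card σ) := by
  classical
  refine iSup_le fun r => iSup_le fun a => iSup_le fun h => ?_
  have h' := indep_lift P a h
  have hall : ∀ s : Finset (Fin r), s.card ≤ (s.biUnion fun i => (a i).support).card := by
    intro s
    set U := s.biUnion fun i => (a i).support
    have hs : LinearIndependent ℂ (fun i : s => a i) := h'.comp _ Subtype.val_injective
    have := linearIndependent_le_span_aux' (fun i : s => a i) hs
      ((U.image (fun β => monomial β (1:ℂ)) : Finset _) : Set (MvPolynomial σ ℂ)) ?_
    · simp only [Fintype.card_coe, Finset.coe_sort_coe] at this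
      exact this.trans Finset.card_image_le
    · rintro _ ⟨i, rfl⟩
      simp only
      rw [(a i).as_sum]
      refine Submodule.sum_mem _ fun β hβ => ?_
      have h1 : monomial β (coeff β (a i)) = (coeff β (a i)) • (monomial β (1:ℂ)) := by
        rw [smul_monomial]; simp
      rw [h1]
      refine Submodule.smul_mem _ _ (Submodule.subset_span ?_)
      simp only [Finset.coe_image, Set.mem_image, Finset.mem_coe]
      exact ⟨β, Finset.mem_biUnion.2 ⟨i, i.2, hβ⟩, rfl⟩
  obtain ⟨β, hβi, hβ⟩ := (Finset.all_card_le_biUnion_card_iff_exists_injective _).1 hall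
  rw [← tsum_geom_finsupp]
  calc ∑ i, z ^ (a i).totalDegree ≤ ∑ i, z ^ (β i).degree := by
        refine Finset.sum_le_sum fun i _ => pow_le_pow_right_of_le_one' hz ?_
        have := le_totalDegree (hβ i)
        simpa [Finsupp.degree_eq_sum, Finsupp.sum_fintype] using this
    _ = ∑' i, z ^ (β i).degree := (tsum_fintype _).symm
    _ ≤ _ := ENNReal.tsum_comp_le_tsum_of_injective hβi (fun b => z ^ b.degree)

lemma exists_tb {R S σ : Type} [CommRing R] [CommRing S] [IsDomain S] [Algebra R S]
    [FaithfulSMul R S] (x : σ → S) (hx : Algebra.adjoin R (Set.range x) = ⊤) :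
    ∃ (J : Type) (e : J → σ), Function.Injective e ∧ IsTranscendenceBasis R (fun j : J => x (e j)) := by
  haveI : Algebra.IsAlgebraic (Algebra.adjoin R (Set.range x)) S := by
    rw [hx]
    refine ⟨fun a => ?_⟩
    haveI : Nontrivial (⊤ : Subalgebra R S) := by
      exact Subalgebra.topEquiv.toEquiv.nontrivial
    exact isAlgebraic_algebraMap (⟨a, trivial⟩ : (⊤ : Subalgebra R S))
  obtain ⟨u, -, hu, hb⟩ := exists_isTranscendenceBasis_between (R := R) (∅ : Set S) (Set.range x)
    (Set.empty_subset _) (by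
      have : Function.Injective (algebraMap R S) := FaithfulSMul.algebraMap_injective R S
      exact (algebraicIndependent_empty_type_iff).2 this)
  choose e he using fun j : u => hu j.2
  refine ⟨u, e, ?_, ?_⟩
  · intro a b hab
    apply Subtype.ext
    rw [← he a, ← he b, hab]
  · simpa [he] using hb

lemma indep_monomials {R S J : Type} [CommRing R] [CommRing S] [Algebra R S] (x : J → S)
    (hx : AlgebraicIndependent R x) :
    LinearIndependent R (fun β : J →₀ ℕ => aeval (R := R) x (monomial β (1:R))) := by
  have := (basisMonomials J R).linearIndependent.map' (aeval (R := R) x).toLinearMap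
    (LinearMap.ker_eq_bot.2 hx)
  simpa [Function.comp_def] using this

lemma adjoin_mkX {σ : Type} (P : Ideal (MvPolynomial σ ℂ)) :
    Algebra.adjoin ℂ (Set.range fun i => Ideal.Quotient.mk P (X i)) = ⊤ := by
  have hx : aeval (R := ℂ) (fun i => Ideal.Quotient.mk P (X i)) = Ideal.Quotient.mkₐ ℂ P := by
    ext i; simp only [aeval_X]; rfl
  rw [Algebra.adjoin_range_eq_range_aeval, AlgHom.range_eq_top, hx]
  exact Ideal.Quotient.mkₐ_surjective ℂ P

lemma KF_ge {σ : Type} [Fintype σ] (P : Ideal (MvPolynomial σ ℂ)) [hP : P.IsPrime] (z : ℝ≥0∞) :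
    ((1 - z)⁻¹) ^ (pdim P) ≤ KF P z := by
  haveI : FaithfulSMul ℂ (MvPolynomial σ ℂ ⧸ P) :=
    (faithfulSMul_iff_algebraMap_injective _ _).2 (algebraMap ℂ (MvPolynomial σ ℂ ⧸ P)).injective
  obtain ⟨J, e, he, hb⟩ := exists_tb (R := ℂ) (fun i => Ideal.Quotient.mk P (X i)) (adjoin_mkX P)
  haveI : Fintype J := Fintype.ofInjective e he
  have hc : Fintype.card J = pdim P := by
    have := hb.cardinalMk_eq_trdeg
    rw [trdeg_fin, Cardinal.mk_fintype] at this
    exact_mod_cast this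
  rw [← hc, ← tsum_geom_finsupp]
  have h1 := indep_monomials _ hb.1
  have h2 : ∀ β : J →₀ ℕ, aeval (fun j => Ideal.Quotient.mk P (X (e j))) (monomial β (1:ℂ))
    = Ideal.Quotient.mk P (rename e (monomial β 1)) := by
    intro β
    have : aeval (R := ℂ) (fun j => Ideal.Quotient.mk P (X (e j))) = 
      (Ideal.Quotient.mkₐ ℂ P).comp (rename e) := by
      ext i; simp only [aeval_X, AlgHom.comp_apply, rename_X]; rfl
    rw [this]; rfl
  simp_rw [h2] at h1
  refine le_trans (le_of_eq ?_) (tsum_le_KF P z _ h1)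
  refine tsum_congr fun β => ?_
  congr 1
  rw [rename_monomial, totalDegree_monomial _ one_ne_zero, Finsupp.sum_mapDomain_index]
  · rfl
  · simp
  · simp

lemma totalDegree_algHom_le {σ τ : Type} (ψ : MvPolynomial σ ℂ →ₐ[ℂ] MvPolynomial τ ℂ) (e : ℕ)
    (h : ∀ i, (ψ (X i)).totalDegree ≤ e) (a : MvPolynomial σ ℂ) :
    (ψ a).totalDegree ≤ e * a.totalDegree := by
  conv_lhs => rw [a.as_sum, map_sum]
  refine totalDegree_finsetSum_le fun β hβ => ?_
  rw [monomial_eq, map_mul]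
  have hC : ψ (C (coeff β a)) = C (coeff β a) := ψ.commutes _
  rw [hC]
  refine (totalDegree_mul _ _).trans ?_
  rw [totalDegree_C, zero_add, Finsupp.prod, map_prod]
  refine (totalDegree_finset_prod _ _).trans ?_
  have : ∀ i ∈ β.support, (ψ (X i ^ β i)).totalDegree ≤ e * β i := by
    intro i _
    rw [map_pow]
    refine (totalDegree_pow _ _).trans ?_
    rw [mul_comm]
    exact Nat.mul_le_mul_right _ (h i)
  refine (Finset.sum_le_sum this).trans ?_
  rw [← Finset.mul_sum]
  exact Nat.mul_le_mul_left _ (le_totalDegree hβ)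

lemma KF_image {σ τ : Type} [Fintype σ] [Fintype τ] 
    (ψ : MvPolynomial σ ℂ →ₐ[ℂ] MvPolynomial τ ℂ) (e : ℕ)
    (h : ∀ i, (ψ (X i)).totalDegree ≤ e) :
    ∃ j, j + pdim (RingHom.ker ψ) = Fintype.card τ ∧
      ∀ z : ℝ≥0∞, z ≤ 1 → KF (RingHom.ker ψ) (z ^ e) * ((1 - z)⁻¹) ^ j ≤ ((1 - z)⁻¹) ^ (Fintype.card τ) := by
  let R := ψ.range
  haveI : FaithfulSMul ℂ R :=
    (faithfulSMul_iff_algebraMap_injective _ _).2 (algebraMap ℂ R).injective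
  obtain ⟨J, ε, he, hb⟩ := exists_tb (R := R) (S := MvPolynomial τ ℂ) (X : τ → MvPolynomial τ ℂ) (by
    rw [eq_top_iff]
    intro x _
    have h1 : x ∈ Algebra.adjoin ℂ (Set.range (X : τ → MvPolynomial τ ℂ)) := by
      rw [adjoin_range_X]; trivial
    have h2 : Algebra.adjoin ℂ (Set.range (X : τ → MvPolynomial τ ℂ)) ≤ 
      (Algebra.adjoin R (Set.range (X : τ → MvPolynomial τ ℂ))).restrictScalars ℂ := 
      Algebra.adjoin_le Algebra.subset_adjoin
    exact h2 h1)
  haveI : Fintype J := Fintype.ofInjective ε he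
  refine ⟨Fintype.card J, ?_, ?_⟩
  · have h1 := hb.cardinalMk_eq_trdeg
    have h2 := trdeg_add_eq ℂ R (A := MvPolynomial τ ℂ)
    have h3 : Algebra.trdeg ℂ R = pdim (RingHom.ker ψ) := by
      rw [← trdeg_fin]
      exact (Ideal.quotientKerEquivRange ψ).symm.trdeg_eq
    rw [← h1, h3, MvPolynomial.trdeg_of_isDomain, Cardinal.mk_fintype, Cardinal.mk_fintype] at h2
    simp at h2
    rw [add_comm]
    exact_mod_cast h2
  · intro z hz
    rw [← tsum_geom_finsupp J]
    refine le_trans ?_ (KF_le (⊥ : Ideal (MvPolynomial τ ℂ)) z hz)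
    unfold KF
    simp only [ENNReal.iSup_mul]
    refine iSup_le fun r => iSup_le fun a => iSup_le fun ha => ?_
    have h1 : LinearIndependent ℂ (fun i => (⟨ψ (a i), a i, rfl⟩ : R)) := by
      have := ha.map' (Ideal.quotientKerEquivRange ψ).toLinearMap (LinearMap.ker_eq_bot.2 (Ideal.quotientKerEquivRange ψ).injective)
      exact this
    have h2 := indep_monomials _ hb.1
    have h3 := linearIndependent_smul h1 h2
    have h4 : LinearIndependent ℂ (fun p : Fin r × (J →₀ ℕ) => 
      Ideal.Quotient.mk (⊥ : Ideal (MvPolynomial τ ℂ)) (ψ (a p.1) * monomial (p.2.mapDomain ε) 1)) := by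
      have := h3.map' (Ideal.Quotient.mkₐ ℂ (⊥ : Ideal (MvPolynomial τ ℂ))).toLinearMap (by
        rw [LinearMap.ker_eq_bot]
        intro x y hxy
        have := Ideal.Quotient.eq.1 hxy
        simpa [sub_eq_zero] using this)
      refine (linearIndependent_equiv' (Equiv.refl _) ?_).1 this
      funext p
      simp only [Function.comp, Equiv.refl_apply]
      have e1 : (aeval (R := R) fun j => (X (ε j) : MvPolynomial τ ℂ)) (monomial p.2 (1:R)) =
          monomial (p.2.mapDomain ε) 1 := by
        rw [aeval_monomial, map_one, one_mul, monomial_eq, C_1, one_mul,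
          Finsupp.prod_mapDomain_index (by simp) (by intros; rw [pow_add])]
      rw [e1]
      rfl
    have h5 := tsum_le_KF _ z _ h4
    refine le_trans ?_ h5
    rw [ENNReal.tsum_prod', Finset.sum_mul, ← tsum_fintype (L := .unconditional _)]
    refine ENNReal.tsum_le_tsum fun i => ?_
    rw [← ENNReal.tsum_mul_left]
    refine ENNReal.tsum_le_tsum fun β => ?_
    rw [← pow_mul, ← pow_add]
    refine pow_le_pow_right_of_le_one' hz ?_
    refine (totalDegree_mul _ _).trans (add_le_add (totalDegree_algHom_le ψ e h _) ?_)
    rw [totalDegree_monomial _ one_ne_zero, Finsupp.sum_mapDomain_index]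
    · rfl
    · simp
    · simp

lemma KF_seq {σ : Type} (P : Ideal (MvPolynomial σ ℂ)) (z : ℝ≥0∞) :
    ∃ u : ℕ → (Σ r : ℕ, Fin r → MvPolynomial σ ℂ),
      (∀ n, LinearIndependent ℂ (fun i => Ideal.Quotient.mk P ((u n).2 i))) ∧
      Filter.Tendsto (fun n => ∑ i, z ^ ((u n).2 i).totalDegree) Filter.atTop (nhds (KF P z)) := by
  set S : Set ℝ≥0∞ := {s | ∃ v : (Σ r : ℕ, Fin r → MvPolynomial σ ℂ),
    LinearIndependent ℂ (fun i => Ideal.Quotient.mk P (v.2 i)) ∧ ∑ i, z ^ (v.2 i).totalDegree = s} with hS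
  have hne : S.Nonempty := ⟨_, ⟨0, Fin.elim0⟩, linearIndependent_empty_type, rfl⟩
  obtain ⟨u, -, hu, huS⟩ := exists_seq_tendsto_sSup hne (OrderTop.bddAbove S)
  choose v hv hvu using huS
  refine ⟨v, hv, ?_⟩
  have : sSup S = KF P z := by
    apply le_antisymm
    · refine sSup_le ?_
      rintro _ ⟨v, hv, rfl⟩
      exact sum_le_KF P z _ hv
    · refine iSup_le fun r => iSup_le fun a => iSup_le fun h => ?_
      exact le_sSup ⟨⟨r, a⟩, h, rfl⟩
  rw [← this]
  refine hu.congr fun n => (hvu n).symm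

lemma sep_elt {A : Type} [CommRing A] (I : Ideal A) (T : Finset (Ideal A)) 
    (hT : ∀ Q ∈ T, Q ∈ I.minimalPrimes) (Q : Ideal A) (hQ : Q ∈ T) :
    ∃ g, g ∉ Q ∧ ∀ Q' ∈ T, Q' ≠ Q → g ∈ Q' := by
  classical
  have h1 : ∀ Q' : Ideal A, ∃ x, Q' ∈ T → Q' ≠ Q → x ∈ Q' ∧ x ∉ Q := by
    intro Q'
    by_cases h : Q' ∈ T ∧ Q' ≠ Q
    · have : ¬ Q' ≤ Q := fun hle => h.2 (le_antisymm hle ((hT Q hQ).2 (hT Q' h.1).1 hle))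
      obtain ⟨x, hx, hx'⟩ := Set.not_subset.1 this
      exact ⟨x, fun _ _ => ⟨hx, hx'⟩⟩
    · exact ⟨0, fun a b => absurd ⟨a, b⟩ h⟩
  choose x hx using h1
  haveI := (hT Q hQ).1.1
  refine ⟨∏ Q' ∈ T.erase Q, x Q', ?_, ?_⟩
  · rw [Ideal.IsPrime.prod_mem_iff]
    push Not
    intro Q' hQ'
    rw [Finset.mem_erase] at hQ'
    exact (hx Q' hQ'.2 hQ'.1).2
  · intro Q' hQ' hne
    exact Ideal.prod_mem _ (Finset.mem_erase.2 ⟨hne, hQ'⟩) (hx Q' hQ' hne).1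

lemma KF_cut {σ : Type} (P : Ideal (MvPolynomial σ ℂ)) [hP : P.IsPrime]
    (f : MvPolynomial σ ℂ) (hf : f ∉ P) (hd : f.totalDegree ≤ 1) (T : Finset (Ideal (MvPolynomial σ ℂ)))
    (hT : ∀ Q ∈ T, Q ∈ (P ⊔ Ideal.span {f}).minimalPrimes) :
    ∃ c : ℕ, ∀ z : ℝ≥0∞, z ≤ 1 → z ^ c * ∑ Q ∈ T, KF Q z + z * KF P z ≤ KF P z := by
  classical
  have hsep := fun Q : T => sep_elt _ T hT Q.1 Q.2
  choose g hg1 hg2 using hsep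
  refine ⟨Finset.univ.sup fun Q => (g Q).totalDegree, fun z hz => ?_⟩
  set c := Finset.univ.sup fun Q => (g Q).totalDegree with hc
  obtain ⟨u, hu, hul⟩ := KF_seq P z
  have hseq := fun Q : T => KF_seq Q.1 z
  choose v hv hvl using hseq
  have hz' : z ≠ ⊤ := ne_top_of_le_ne_top ENNReal.one_ne_top hz
  have hlim : Filter.Tendsto (fun n => z ^ c * ∑ Q : T, ∑ i, z ^ ((v Q n).2 i).totalDegree +
      z * ∑ i, z ^ ((u n).2 i).totalDegree) Filter.atTop
      (nhds (z ^ c * ∑ Q : T, KF Q.1 z + z * KF P z)) := by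
    refine Filter.Tendsto.add ?_ ?_
    · exact ENNReal.Tendsto.const_mul (tendsto_finset_sum _ fun Q _ => hvl Q) 
        (Or.inr (ENNReal.pow_ne_top hz'))
    · exact ENNReal.Tendsto.const_mul hul (Or.inr hz')
  rw [← Finset.sum_coe_sort]
  refine le_of_tendsto' hlim fun n => ?_
  have key := sum_le_KF P z (ι := (Σ Q : T, Fin (v Q n).1) ⊕ Fin (u n).1)
    (Sum.elim (fun p => g p.1 * (v p.1 n).2 p.2) (fun j => f * (u n).2 j)) ?_
  · refine le_trans ?_ key
    rw [Fintype.sum_sum_type, Fintype.sum_sigma]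
    simp only [Sum.elim_inl, Sum.elim_inr, Finset.mul_sum]
    refine add_le_add (Finset.sum_le_sum fun Q _ => Finset.sum_le_sum fun i _ => ?_) 
      (Finset.sum_le_sum fun i _ => ?_)
    · rw [← pow_add]
      refine pow_le_pow_right_of_le_one' hz ((totalDegree_mul _ _).trans (Nat.add_le_add_right ?_ _))
      exact Finset.le_sup (f := fun Q => (g Q).totalDegree) (Finset.mem_univ Q)
    · rw [← pow_succ']
      refine pow_le_pow_right_of_le_one' hz ((totalDegree_mul _ _).trans ?_)
      omega
  · rw [Fintype.linearIndependent_iff]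
    intro w hw
    rw [Fintype.sum_sum_type, Fintype.sum_sigma] at hw
    simp only [Sum.elim_inl, Sum.elim_inr] at hw
    have hmem : ∑ Q : T, g Q * ∑ i, (w (Sum.inl ⟨Q, i⟩)) • (v Q n).2 i + 
        f * ∑ j, w (Sum.inr j) • (u n).2 j ∈ P := by
      rw [← Ideal.Quotient.eq_zero_iff_mem, ← hw]
      simp only [Finset.mul_sum, map_add, map_sum, mul_smul_comm]
      rfl
    have hfQ : ∀ Q : T, f ∈ Q.1 := fun Q => (hT Q.1 Q.2).1.2 (le_sup_right (a := P) (Ideal.mem_span_singleton_self f))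
    have hPQ : ∀ Q : T, P ≤ Q.1 := fun Q => le_sup_left.trans (hT Q.1 Q.2).1.2
    have h1 : ∀ Q : T, ∀ i, w (Sum.inl ⟨Q, i⟩) = 0 := by
      intro Q
      haveI := (hT Q.1 Q.2).1.1
      have h2 := hPQ Q hmem
      rw [← Finset.add_sum_erase _ _ (Finset.mem_univ Q), add_assoc] at h2
      have h3 := (Ideal.add_mem_iff_left _ (Ideal.add_mem _ (Ideal.sum_mem _ fun Q' hQ' => ?_) (Ideal.mul_mem_right _ _ (hfQ Q)))).1 h2
      · have h4 := (Ideal.IsPrime.mem_or_mem ‹_› h3).resolve_left (hg1 Q)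
        have h5 := Fintype.linearIndependent_iff.1 (hv Q n) (fun i => w (Sum.inl ⟨Q, i⟩)) (by
          rw [← Ideal.Quotient.eq_zero_iff_mem, map_sum] at h4
          exact h4)
        exact h5
      · refine Ideal.mul_mem_right _ _ (hg2 Q' Q.1 Q.2 ?_)
        simp at hQ'
        exact fun h => hQ' (Subtype.ext h.symm)
    simp only [h1, zero_smul, Finset.sum_const_zero, mul_zero, zero_add] at hmem
    have h4 := (hP.mem_or_mem hmem).resolve_left hf
    have h5 := Fintype.linearIndependent_iff.1 (hu n) (fun i => w (Sum.inr i)) (by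
          rw [← Ideal.Quotient.eq_zero_iff_mem, map_sum] at h4
          exact h4)
    rintro (⟨Q, i⟩ | j)
    · exact h1 Q i
    · exact h5 j

lemma neBot_lt_one : (nhdsWithin (1 : ℝ≥0∞) (Set.Iio 1)).NeBot := 
  nhdsLT_neBot_of_exists_lt ⟨0, zero_lt_one⟩

noncomputable def UU : Ultrafilter ℝ≥0∞ :=
  haveI := neBot_lt_one
  Ultrafilter.of (nhdsWithin (1 : ℝ≥0∞) (Set.Iio 1))

lemma UU_le : (UU : Filter ℝ≥0∞) ≤ nhdsWithin (1 : ℝ≥0∞) (Set.Iio 1) :=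
  haveI := neBot_lt_one
  Ultrafilter.of_le _

lemma UU_lt : ∀ᶠ z in (UU : Filter ℝ≥0∞), z < 1 := UU_le self_mem_nhdsWithin

lemma UU_id : Filter.Tendsto (fun z : ℝ≥0∞ => z) (UU : Filter ℝ≥0∞) (nhds 1) :=
  (UU_le.trans nhdsWithin_le_nhds)

lemma UU_lim (F : ℝ≥0∞ → ℝ≥0∞) : ∃ x, Filter.Tendsto F (UU : Filter ℝ≥0∞) (nhds x) := by
  obtain ⟨x, -, hx⟩ := isCompact_univ.ultrafilter_le_nhds (UU.map F) (by simp)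
  exact ⟨x, hx⟩

noncomputable def pdeg {σ : Type} (P : Ideal (MvPolynomial σ ℂ)) : ℝ≥0∞ :=
  (UU_lim fun z => (1 - z) ^ (pdim P) * KF P z).choose

lemma pdeg_tendsto {σ : Type} (P : Ideal (MvPolynomial σ ℂ)) :
    Filter.Tendsto (fun z => (1 - z) ^ (pdim P) * KF P z) (UU : Filter ℝ≥0∞) (nhds (pdeg P)) :=
  (UU_lim fun z => (1 - z) ^ (pdim P) * KF P z).choose_spec

lemma one_le_pdeg {σ : Type} [Fintype σ] (P : Ideal (MvPolynomial σ ℂ)) [P.IsPrime] : 1 ≤ pdeg P := by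
  refine ge_of_tendsto (pdeg_tendsto P) (UU_lt.mono fun z hz => ?_)
  have h := KF_ge P z
  have h0 : 1 - z ≠ 0 := (tsub_pos_of_lt hz).ne'
  have h1 : 1 - z ≠ ⊤ := ENNReal.sub_ne_top ENNReal.one_ne_top
  calc (1 : ℝ≥0∞) = (1 - z) ^ (pdim P) * ((1 - z)⁻¹) ^ (pdim P) := by
        rw [← mul_pow, ENNReal.mul_inv_cancel h0 h1, one_pow]
    _ ≤ _ := by gcongr

lemma pdeg_cut {σ : Type} [Fintype σ] (P : Ideal (MvPolynomial σ ℂ)) [hP : P.IsPrime]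
    (f : MvPolynomial σ ℂ) (hf : f ∉ P) (hd : f.totalDegree ≤ 1) (T : Finset (Ideal (MvPolynomial σ ℂ)))
    (hT : ∀ Q ∈ T, Q ∈ (P ⊔ Ideal.span {f}).minimalPrimes) :
    ∑ Q ∈ T, pdeg Q ≤ pdeg P := by
  obtain ⟨c, hc⟩ := KF_cut P f hf hd T hT
  have h1 : Filter.Tendsto (fun z : ℝ≥0∞ => z ^ c * ∑ Q ∈ T, (1 - z) ^ (pdim Q) * KF Q z)
      (UU : Filter ℝ≥0∞) (nhds (1 * ∑ Q ∈ T, pdeg Q)) := by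
    refine ENNReal.Tendsto.mul ?_ (Or.inl one_ne_zero) (tendsto_finset_sum _ fun Q _ => pdeg_tendsto Q)
      (Or.inr ENNReal.one_ne_top)
    have := ((ENNReal.continuous_pow c).tendsto 1).comp UU_id
    rw [one_pow] at this
    exact this
  rw [one_mul] at h1
  refine le_of_tendsto_of_tendsto h1 (pdeg_tendsto P) (UU_lt.mono fun z hz => ?_)
  simp only
  have h0 : 1 - z ≠ 0 := (tsub_pos_of_lt hz).ne'
  have hfin : KF P z ≠ ⊤ := by
    refine ne_top_of_le_ne_top ?_ (KF_le P z hz.le)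
    exact ENNReal.pow_ne_top (ENNReal.inv_ne_top.2 h0)
  have h2 : z ^ c * ∑ Q ∈ T, KF Q z ≤ (1 - z) * KF P z := by
    rw [ENNReal.sub_mul (fun _ _ => hfin), one_mul]
    exact ENNReal.le_sub_of_add_le_right (ENNReal.mul_ne_top hz.ne_top hfin) (hc z hz.le)
  rcases T.eq_empty_or_nonempty with rfl | ⟨Q0, hQ0⟩
  · simp
  have h3 : ∑ Q ∈ T, (1 - z) ^ (pdim Q) * KF Q z = (1 - z) ^ (pdim Q0) * ∑ Q ∈ T, KF Q z := by
    rw [Finset.mul_sum]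
    refine Finset.sum_congr rfl fun Q hQ => ?_
    have e1 := pdim_cut P f hf Q (hT Q hQ)
    have e2 := pdim_cut P f hf Q0 (hT Q0 hQ0)
    rw [show pdim Q = pdim Q0 by omega]
  rw [h3, ← pdim_cut P f hf Q0 (hT Q0 hQ0), mul_left_comm, pow_succ, mul_assoc]
  gcongr

lemma bern (z : ℝ≥0∞) (hz : z ≤ 1) (e : ℕ) : 1 - z ^ e ≤ e * (1 - z) := by
  rw [tsub_le_iff_left]
  induction e with
  | zero => simp
  | succ e ih =>
    refine ih.trans ?_
    have h1 : z + (1 - z) = 1 := add_tsub_cancel_of_le hz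
    have h2 : z ^ e ≤ z ^ (e + 1) + (1 - z) := by
      calc z ^ e = z ^ e * (z + (1 - z)) := by rw [h1, mul_one]
        _ = z ^ (e+1) + z ^ e * (1 - z) := by rw [mul_add, pow_succ]
        _ ≤ z ^ (e+1) + 1 * (1 - z) := by gcongr; exact pow_le_one' hz e
        _ = _ := by rw [one_mul]
    calc z ^ e + e * (1 - z) ≤ (z ^ (e + 1) + (1 - z)) + e * (1 - z) := by gcongr
      _ = _ := by push_cast; ring

lemma pdeg_image {σ τ : Type} [Fintype σ] [Fintype τ] 
    (ψ : MvPolynomial σ ℂ →ₐ[ℂ] MvPolynomial τ ℂ) (e : ℕ) (he : 1 ≤ e)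
    (h : ∀ i, (ψ (X i)).totalDegree ≤ e) :
    pdim (RingHom.ker ψ) ≤ Fintype.card τ ∧ pdeg (RingHom.ker ψ) ≤ (e : ℝ≥0∞) ^ (pdim (RingHom.ker ψ)) := by
  obtain ⟨j, hj, hK⟩ := KF_image ψ e h
  refine ⟨by omega, ?_⟩
  refine le_of_tendsto (pdeg_tendsto _) (UU_lt.mono fun w hw => ?_)
  obtain ⟨z, rfl⟩ : ∃ z : ℝ≥0∞, z ^ e = w := ⟨w ^ ((e:ℝ)⁻¹), by
    rw [← ENNReal.rpow_natCast, ← ENNReal.rpow_mul, inv_mul_cancel₀ (by positivity), ENNReal.rpow_one]⟩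
  have hz : z < 1 := by
    by_contra hcon
    push Not at hcon
    exact absurd hw (not_lt.2 (one_le_pow₀ hcon))
  have h0 : 1 - z ≠ 0 := (tsub_pos_of_lt hz).ne'
  have h1 : 1 - z ≠ ⊤ := ENNReal.sub_ne_top ENNReal.one_ne_top
  have h2 := hK z hz.le
  set d := pdim (RingHom.ker ψ)
  set k := KF (RingHom.ker ψ) (z ^ e)
  have h3 : (1 - z) ^ d * k ≤ 1 := by
    calc (1 - z) ^ d * k = (1 - z) ^ (Fintype.card τ) * (k * ((1 - z)⁻¹) ^ j) := by
          rw [← hj, pow_add, mul_comm k, ← mul_assoc, mul_right_comm ((1-z)^j), ← mul_pow, ENNReal.mul_inv_cancel h0 h1, one_pow, one_mul]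
      _ ≤ (1 - z) ^ (Fintype.card τ) * ((1 - z)⁻¹) ^ (Fintype.card τ) := by gcongr
      _ = 1 := by rw [← mul_pow, ENNReal.mul_inv_cancel h0 h1, one_pow]
  calc (1 - z ^ e) ^ d * k ≤ (e * (1 - z)) ^ d * k := by gcongr; exact bern z hz.le e
    _ = e ^ d * ((1 - z) ^ d * k) := by rw [mul_pow, mul_assoc]
    _ ≤ e ^ d * 1 := by gcongr
    _ = _ := mul_one _

lemma box_card1 {t M : ℕ} (i : Fin t) (U : Finset (Fin M)) :
    (Finset.univ.filter fun a : Fin t → Fin M => a i ∈ U).card * M = U.card * M ^ t := by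
  classical
  have h : (Finset.univ.filter fun a : Fin t → Fin M => a i ∈ U) =
      Fintype.piFinset (fun k => if k = i then U else Finset.univ) := by
    ext a
    simp only [Finset.mem_filter, Finset.mem_univ, true_and, Fintype.mem_piFinset]
    constructor
    · intro h k
      split_ifs with hk
      · rwa [hk]
      · simp
    · intro h
      simpa using h i
  rw [h, Fintype.card_piFinset, ← Finset.mul_prod_erase _ _ (Finset.mem_univ i)]
  rw [Finset.prod_congr rfl (g := fun _ => M)]
  · simp only [if_true, Finset.prod_const, Finset.card_erase_of_mem (Finset.mem_univ i), Finset.card_univ, Fintype.card_fin, mul_assoc]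
    rw [← pow_succ]
    have := i.pos
    congr 2; omega
  · intro k hk
    rw [if_neg (Finset.ne_of_mem_erase hk)]; simp

lemma box_card2 {t M : ℕ} (i j : Fin t) (hij : i ≠ j) (U W : Finset (Fin M)) :
    (Finset.univ.filter fun a : Fin t → Fin M => a i ∈ U ∧ a j ∈ W).card * M ^ 2 = U.card * W.card * M ^ t := by
  classical
  have h : (Finset.univ.filter fun a : Fin t → Fin M => a i ∈ U ∧ a j ∈ W) =
      Fintype.piFinset (fun k => if k = i then U else if k = j then W else Finset.univ) := by
    ext a
    simp only [Finset.mem_filter, Finset.mem_univ, true_and, Fintype.mem_piFinset]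
    constructor
    · intro h k
      split_ifs with hk hk
      · rw [hk]; exact h.1
      · rw [hk]; exact h.2
      · simp
    · intro h
      exact ⟨by simpa using h i, by simpa [hij.symm] using h j⟩
  have hj : j ∈ Finset.univ.erase i := Finset.mem_erase.2 ⟨hij.symm, Finset.mem_univ j⟩
  rw [h, Fintype.card_piFinset, ← Finset.mul_prod_erase _ _ (Finset.mem_univ i), ← Finset.mul_prod_erase _ _ hj]
  rw [Finset.prod_congr rfl (g := fun _ => M)]
  · simp only [if_true, if_neg hij.symm, Finset.prod_const, Finset.card_erase_of_mem hj, Finset.card_erase_of_mem (Finset.mem_univ i), Finset.card_univ, Fintype.card_fin, mul_assoc]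
    rw [← pow_add]
    have h1 : (Finset.univ.erase i).card ≠ 0 := by
      rw [Finset.card_ne_zero]; exact ⟨j, hj⟩
    simp at h1
    congr 3; omega
  · intro k hk
    rw [if_neg (Finset.ne_of_mem_erase (Finset.mem_of_mem_erase hk)), if_neg (Finset.ne_of_mem_erase hk)]; simp

lemma fin_range_card (M l u : ℕ) :
    (Finset.univ.filter fun x : Fin M => l ≤ (x : ℕ) ∧ (x : ℕ) < u).card ≤ u - l := by
  classical
  have : ((Finset.univ.filter fun x : Fin M => l ≤ (x : ℕ) ∧ (x : ℕ) < u).image Fin.val) ⊆ Finset.Ico l u := by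
    intro x hx
    simp at hx ⊢
    obtain ⟨a, ha, rfl⟩ := hx
    exact ha
  rw [← Finset.card_image_of_injective _ Fin.val_injective]
  exact (Finset.card_le_card this).trans (by simp)

lemma footprint_count {t M Δ : ℕ} (hΔ : 1 ≤ Δ) (hM : Δ + 1 ≤ M) (α β : Fin t → ℕ) (hne : α ≠ β)
    (hα : ∑ i, α i ≤ Δ) (hβ : ∑ i, β i ≤ Δ) :
    (Finset.univ.filter fun a : Fin t → Fin M => (∃ i, (a i : ℕ) < α i) ∧ ∃ j, (a j : ℕ) < β j).card * M ^ 2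
      ≤ ((Δ - 1) * M + 1) * M ^ t := by
  classical
  let δ : Fin t → ℕ := fun i => min (α i) (β i)
  let U : ℕ → ℕ → Finset (Fin M) := fun l u => Finset.univ.filter fun x : Fin M => l ≤ (x : ℕ) ∧ (x : ℕ) < u
  let E1 : Fin t → Finset (Fin t → Fin M) := fun i => Finset.univ.filter fun a => a i ∈ U 0 (δ i)
  let E2 : Fin t × Fin t → Finset (Fin t → Fin M) := fun p => if p.1 = p.2 then ∅ else
    Finset.univ.filter fun a => a p.1 ∈ U (δ p.1) (α p.1) ∧ a p.2 ∈ U (δ p.2) (β p.2)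
  have hsub : (Finset.univ.filter fun a : Fin t → Fin M => (∃ i, (a i : ℕ) < α i) ∧ ∃ j, (a j : ℕ) < β j) ⊆
      (Finset.univ.biUnion E1) ∪ (Finset.univ.biUnion E2) := by
    intro a ha
    simp only [Finset.mem_filter, Finset.mem_univ, true_and] at ha
    obtain ⟨⟨i, hi⟩, j, hj⟩ := ha
    rw [Finset.mem_union, Finset.mem_biUnion, Finset.mem_biUnion]
    by_cases hi' : (a i : ℕ) < δ i
    · left; exact ⟨i, Finset.mem_univ _, by simp [E1, U, hi']⟩
    by_cases hj' : (a j : ℕ) < δ j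
    · left; exact ⟨j, Finset.mem_univ _, by simp [E1, U, hj']⟩
    right
    refine ⟨(i, j), Finset.mem_univ _, ?_⟩
    have hij : i ≠ j := by
      rintro rfl
      exact hi' (lt_min hi hj)
    simp only [E2, if_neg hij, U, Finset.mem_filter, Finset.mem_univ, true_and]
    exact ⟨⟨not_lt.1 hi', hi⟩, not_lt.1 hj', hj⟩
  set e := ∑ i, δ i with he
  have hαe : ∑ i, (α i - δ i) + e = ∑ i, α i := by
    rw [he, ← Finset.sum_add_distrib]
    exact Finset.sum_congr rfl fun i _ => Nat.sub_add_cancel (min_le_left _ _)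
  have hβe : ∑ i, (β i - δ i) + e = ∑ i, β i := by
    rw [he, ← Finset.sum_add_distrib]
    exact Finset.sum_congr rfl fun i _ => Nat.sub_add_cancel (min_le_right _ _)
  have heΔ : e + 1 ≤ Δ := by
    by_contra hcon
    have h1 : ∑ i, (α i - δ i) = 0 := by omega
    have h2 : ∑ i, (β i - δ i) = 0 := by omega
    apply hne
    funext i
    have h3 := (Finset.sum_eq_zero_iff.1 h1) i (Finset.mem_univ i)
    have h4 := (Finset.sum_eq_zero_iff.1 h2) i (Finset.mem_univ i)
    have h5 : δ i ≤ α i := min_le_left _ _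
    have h6 : δ i ≤ β i := min_le_right _ _
    omega
  have hc1 : (Finset.univ.biUnion E1).card * M ≤ e * M ^ t := by
    calc _ ≤ (∑ i, (E1 i).card) * M := Nat.mul_le_mul_right _ Finset.card_biUnion_le
      _ = ∑ i, (E1 i).card * M := Finset.sum_mul ..
      _ ≤ ∑ i, δ i * M ^ t := by
          refine Finset.sum_le_sum fun i _ => ?_
          rw [box_card1]
          exact Nat.mul_le_mul_right _ ((fin_range_card M 0 (δ i)).trans (by simp))
      _ = _ := by rw [← Finset.sum_mul]
  have hc2 : (Finset.univ.biUnion E2).card * M ^ 2 ≤ ((∑ i, (α i - δ i)) * (∑ i, (β i - δ i))) * M ^ t := by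
    calc _ ≤ (∑ p, (E2 p).card) * M ^ 2 := Nat.mul_le_mul_right _ Finset.card_biUnion_le
      _ = ∑ p, (E2 p).card * M ^ 2 := Finset.sum_mul ..
      _ ≤ ∑ p : Fin t × Fin t, ((α p.1 - δ p.1) * (β p.2 - δ p.2)) * M ^ t := by
          refine Finset.sum_le_sum fun p _ => ?_
          by_cases hp : p.1 = p.2
          · simp [E2, hp]
          · simp only [E2, if_neg hp]
            rw [box_card2 _ _ hp]
            exact Nat.mul_le_mul_right _ (Nat.mul_le_mul (fin_range_card _ _ _) (fin_range_card _ _ _))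
      _ = _ := by rw [← Finset.sum_mul, Fintype.sum_prod_type, Finset.sum_mul_sum]
  obtain ⟨d, hd⟩ : ∃ d, Δ = e + 1 + d := ⟨Δ - (e+1), by omega⟩
  have hab : (∑ i, (α i - δ i)) * (∑ i, (β i - δ i)) ≤ (d + 1) * (d + 1) :=
    Nat.mul_le_mul (by omega) (by omega)
  have hfin : e * M + (d + 1) * (d + 1) ≤ (Δ - 1) * M + 1 := by
    have : Δ - 1 = e + d := by omega
    rw [this]
    have : d * (d + 2) ≤ d * M := Nat.mul_le_mul_left _ (by omega)
    nlinarith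
  calc _ ≤ ((Finset.univ.biUnion E1).card + (Finset.univ.biUnion E2).card) * M ^ 2 :=
        Nat.mul_le_mul_right _ ((Finset.card_le_card hsub).trans (Finset.card_union_le _ _))
    _ = (Finset.univ.biUnion E1).card * M * M + (Finset.univ.biUnion E2).card * M ^ 2 := by ring
    _ ≤ e * M ^ t * M + ((d + 1) * (d + 1)) * M ^ t := by
        refine add_le_add (Nat.mul_le_mul_right _ hc1) (hc2.trans (Nat.mul_le_mul_right _ hab))
    _ = (e * M + (d + 1) * (d + 1)) * M ^ t := by ring
    _ ≤ _ := Nat.mul_le_mul_right _ hfin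

lemma foot_le {t : ℕ} (N : Finset ℂ) (V : Finset (Fin t → ℂ)) (hV : ∀ y ∈ V, ∀ i, y i ∈ N)
    (f g : MvPolynomial (Fin t) ℂ) (hf : f ≠ 0) (hg : g ≠ 0)
    (hfV : ∀ y ∈ V, eval y f = 0) (hgV : ∀ y ∈ V, eval y g = 0) :
    V.card ≤ (Finset.univ.filter fun a : Fin t → Fin N.card =>
      (∃ i, (a i : ℕ) < MonomialOrder.lex.degree f i) ∧ ∃ j, (a j : ℕ) < MonomialOrder.lex.degree g j).card := by
  classical
  set m : MonomialOrder (Fin t) := MonomialOrder.lex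
  set E := (Finset.univ.filter fun a : Fin t → Fin N.card =>
      (∃ i, (a i : ℕ) < m.degree f i) ∧ ∃ j, (a j : ℕ) < m.degree g j) with hE
  let q : Fin t → MvPolynomial (Fin t) ℂ := fun i => ∏ c ∈ N, (X i - C c)
  have hqm : ∀ i, m.Monic (q i) := fun i => MonomialOrder.Monic.prod fun c _ => m.monic_X_sub_C i c
  have hqd : ∀ i, m.degree (q i) = Finsupp.single i N.card := by
    intro i
    rw [MonomialOrder.degree_prod (fun c _ => (m.monic_X_sub_C i c).ne_zero)]
    simp [MonomialOrder.degree_X_sub_C]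
  have hqV : ∀ i, ∀ y ∈ V, eval y (q i) = 0 := by
    intro i y hy
    simp only [q, map_prod]
    exact Finset.prod_eq_zero (hV y hy i) (by simp)
  let B : Set (MvPolynomial (Fin t) ℂ) := {f, g} ∪ Set.range q
  have hBu : ∀ b ∈ B, IsUnit (m.leadingCoeff b) := by
    rintro b ((rfl | rfl) | ⟨i, rfl⟩)
    · exact (IsUnit.mk0 _ (m.leadingCoeff_ne_zero_iff.2 hf))
    · exact (IsUnit.mk0 _ (m.leadingCoeff_ne_zero_iff.2 hg))
    · rw [(hqm i).leadingCoeff_eq_one]; exact isUnit_one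
  have hBV : ∀ b ∈ B, ∀ y ∈ V, eval y b = 0 := by
    rintro b ((rfl | rfl) | ⟨i, rfl⟩)
    · exact hfV
    · exact hgV
    · exact hqV i
  let ev : MvPolynomial (Fin t) ℂ →ₗ[ℂ] (V → ℂ) := LinearMap.pi fun y => (aeval (R := ℂ) y.1).toLinearMap
  have hev : ∀ p y, ev p y = eval y.1 p := by
    intro p y
    simp [ev, aeval_eq_eval]
  have hsurj : LinearMap.range ev = ⊤ := by
    rw [eq_top_iff, ← (Pi.basisFun ℂ V).span_eq, Submodule.span_le]
    rintro _ ⟨y, rfl⟩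
    let I : MvPolynomial (Fin t) ℂ := ∏ i, ∏ c ∈ N.erase (y.1 i), (X i - C c)
    have hI0 : eval y.1 I ≠ 0 := by
      simp only [I, map_prod]
      refine Finset.prod_ne_zero_iff.2 fun i _ => Finset.prod_ne_zero_iff.2 fun c hc => ?_
      simp [sub_eq_zero]
      exact (Finset.ne_of_mem_erase hc).symm
    have hI1 : ∀ y' ∈ V, y' ≠ y.1 → eval y' I = 0 := by
      intro y' hy' hne
      obtain ⟨i, hi⟩ := Function.ne_iff.1 hne
      simp only [I, map_prod]
      refine Finset.prod_eq_zero (Finset.mem_univ i) (Finset.prod_eq_zero (Finset.mem_erase.2 ⟨hi, hV y' hy' i⟩) (by simp))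
    refine ⟨C (eval y.1 I)⁻¹ * I, ?_⟩
    funext y'
    rw [hev, map_mul, eval_C, Pi.basisFun_apply]
    by_cases h : y' = y
    · subst h; simp [hI0]
    · rw [hI1 y'.1 y'.2 (fun h' => h (Subtype.ext h')), Pi.single_eq_of_ne h]; simp
  let mon : (Fin t → Fin N.card) → MvPolynomial (Fin t) ℂ := fun a =>
    monomial (Finsupp.equivFunOnFinite.symm fun i => (a i : ℕ)) 1
  have hspan : Submodule.span ℂ ((E.image fun a => ev (mon a) : Finset (V → ℂ)) : Set (V → ℂ)) = ⊤ := by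
    rw [eq_top_iff, ← hsurj]
    rintro _ ⟨p, rfl⟩
    obtain ⟨h, r, hp, -, hr⟩ := m.div_set hBu p
    have hpr : ev p = ev r := by
      funext y
      rw [hev, hev, hp, map_add, Finsupp.linearCombination_apply, Finsupp.sum, map_sum,
        Finset.sum_eq_zero, zero_add]
      intro b _
      rw [smul_eq_mul, map_mul, hBV b.1 b.2 y.1 y.2, mul_zero]
    rw [hpr, r.as_sum, map_sum]
    refine Submodule.sum_mem _ fun c hc => ?_
    have h1 : monomial c (coeff c r) = (coeff c r) • (monomial c (1:ℂ)) := by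
      rw [smul_monomial]; simp
    rw [h1, map_smul]
    refine Submodule.smul_mem _ _ (Submodule.subset_span ?_)
    simp only [Finset.coe_image, Set.mem_image, Finset.mem_coe]
    have hlt : ∀ i, c i < N.card := by
      intro i
      have := hr c hc (q i) (Or.inr ⟨i, rfl⟩)
      rw [hqd] at this
      by_contra hcon
      apply this
      rw [Finsupp.single_le_iff]
      omega
    have hnot : ∀ b ∈ B, ∃ i, c i < m.degree b i := by
      intro b hb
      have := hr c hc b hb
      by_contra hcon
      push Not at hcon
      exact this hcon
    refine ⟨fun i => ⟨c i, hlt i⟩, ?_, ?_⟩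
    · simp only [hE, Finset.mem_filter, Finset.mem_univ, true_and]
      exact ⟨hnot f (Or.inl (Or.inl rfl)), hnot g (Or.inl (Or.inr rfl))⟩
    · have : (Finsupp.equivFunOnFinite.symm fun i => c i) = c := by ext i; simp
      simp only [mon]
      rw [this]
  have hfin := finrank_span_finset_le_card (R := ℂ) (E.image fun a => ev (mon a))
  rw [Set.finrank, hspan, finrank_top, Module.finrank_fintype_fun_eq_card, Fintype.card_coe] at hfin
  exact hfin.trans Finset.card_image_le

lemma lexdeg_sum_le {t : ℕ} (f : MvPolynomial (Fin t) ℂ) (hf : f ≠ 0) :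
    ∑ i, MonomialOrder.lex.degree f i ≤ f.totalDegree := by
  have := le_totalDegree (MonomialOrder.lex.degree_mem_support hf)
  rwa [Finsupp.sum_fintype _ _ (by simp)] at this

lemma zeros_one {t Δ : ℕ} (N : Finset ℂ) (V : Finset (Fin t → ℂ)) (hV : ∀ y ∈ V, ∀ i, y i ∈ N)
    (f : MvPolynomial (Fin t) ℂ) (hf : f ≠ 0) (hfd : f.totalDegree ≤ Δ) (hfV : ∀ y ∈ V, eval y f = 0) :
    V.card * N.card ≤ Δ * N.card ^ t := by
  classical
  have h1 := foot_le N V hV f f hf hf hfV hfV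
  have h2 := (lexdeg_sum_le f hf).trans hfd
  set α := MonomialOrder.lex.degree f
  have hsub : (Finset.univ.filter fun a : Fin t → Fin N.card =>
      (∃ i, (a i : ℕ) < α i) ∧ ∃ j, (a j : ℕ) < α j) ⊆
      Finset.univ.biUnion fun i => Finset.univ.filter fun a : Fin t → Fin N.card => a i ∈
        Finset.univ.filter fun x : Fin N.card => 0 ≤ (x : ℕ) ∧ (x : ℕ) < α i := by
    intro a ha
    simp only [Finset.mem_filter, Finset.mem_univ, true_and, Finset.mem_biUnion] at ha ⊢
    obtain ⟨⟨i, hi⟩, -⟩ := ha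
    exact ⟨i, by omega, hi⟩
  calc V.card * N.card ≤ _ * N.card := Nat.mul_le_mul_right _ (h1.trans ((Finset.card_le_card hsub).trans Finset.card_biUnion_le))
    _ = _ := Finset.sum_mul ..
    _ ≤ ∑ i, α i * N.card ^ t := by
        refine Finset.sum_le_sum fun i _ => ?_
        rw [box_card1]
        exact Nat.mul_le_mul_right _ ((fin_range_card _ 0 (α i)).trans (by simp))
    _ = (∑ i, α i) * N.card ^ t := by rw [← Finset.sum_mul]
    _ ≤ _ := Nat.mul_le_mul_right _ h2

lemma zeros_two {t Δ : ℕ} (hΔ : 1 ≤ Δ) (N : Finset ℂ) (hN : Δ + 1 ≤ N.card) (V : Finset (Fin t → ℂ))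
    (hV : ∀ y ∈ V, ∀ i, y i ∈ N)
    (f g : MvPolynomial (Fin t) ℂ) (hf : f ≠ 0) (hg : ∀ c : ℂ, g ≠ c • f)
    (hfd : f.totalDegree ≤ Δ) (hgd : g.totalDegree ≤ Δ)
    (hfV : ∀ y ∈ V, eval y f = 0) (hgV : ∀ y ∈ V, eval y g = 0) :
    V.card * N.card ^ 2 ≤ ((Δ - 1) * N.card + 1) * N.card ^ t := by
  classical
  let m : MonomialOrder (Fin t) := MonomialOrder.lex
  let c := (coeff (m.degree f) g) / (m.leadingCoeff f)
  let g' := g - c • f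
  have hlf : m.leadingCoeff f ≠ 0 := m.leadingCoeff_ne_zero_iff.2 hf
  have hg' : g' ≠ 0 := fun h => hg c (sub_eq_zero.1 h)
  have hc : coeff (m.degree f) g' = 0 := by
    simp only [g', coeff_sub, coeff_smul, smul_eq_mul, c]
    rw [show coeff (m.degree f) f = m.leadingCoeff f from rfl, div_mul_cancel₀ _ hlf, sub_self]
  have hne : m.degree f ≠ m.degree g' := by
    intro h
    rw [h] at hc
    exact m.leadingCoeff_ne_zero_iff.2 hg' hc
  have hgd' : g'.totalDegree ≤ Δ :=
    (totalDegree_sub _ _).trans (max_le hgd ((totalDegree_smul_le _ _).trans hfd))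
  have hgV' : ∀ y ∈ V, eval y g' = 0 := by
    intro y hy
    simp [g', smul_eval, hfV y hy, hgV y hy]
  refine le_trans (Nat.mul_le_mul_right _ (foot_le N V hV f g' hf hg' hfV hgV')) ?_
  exact footprint_count hΔ hN _ _ (fun h => hne (DFunLike.coe_injective h))
    ((lexdeg_sum_le f hf).trans hfd) ((lexdeg_sum_le g' hg').trans hgd')

noncomputable def expo {t Δ : ℕ} (α : Fin t → Fin (Δ + 1)) : Fin t →₀ ℕ :=
  Finsupp.equivFunOnFinite.symm fun i => (α i : ℕ)

lemma expo_inj {t Δ : ℕ} : Function.Injective (expo (t := t) (Δ := Δ)) := by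
  intro a b h
  funext i
  have := DFunLike.congr_fun h i
  simp [expo] at this
  exact Fin.ext this

noncomputable def polyOf {t Δ : ℕ} (w : (Fin t → Fin (Δ + 1)) → ℂ) : MvPolynomial (Fin t) ℂ :=
  ∑ α, monomial (expo α) (w α)

lemma eval_polyOf {t Δ : ℕ} (w : (Fin t → Fin (Δ + 1)) → ℂ) (y : Fin t → ℂ) :
    eval y (polyOf w) = evalVec w y := by
  unfold polyOf evalVec
  rw [map_sum]
  refine Finset.sum_congr rfl fun α _ => ?_
  rw [eval_monomial, Finsupp.prod_fintype _ _ (by simp)]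
  simp [expo]

lemma coeff_polyOf {t Δ : ℕ} (w : (Fin t → Fin (Δ + 1)) → ℂ) (α : Fin t → Fin (Δ + 1)) :
    coeff (expo α) (polyOf w) = w α := by
  classical
  unfold polyOf
  rw [coeff_sum, Finset.sum_eq_single α]
  · simp
  · intro b _ hb
    rw [coeff_monomial, if_neg (fun h => hb (expo_inj h))]
  · simp

lemma polyOf_inj {t Δ : ℕ} (w w' : (Fin t → Fin (Δ + 1)) → ℂ) (h : polyOf w = polyOf w') : w = w' := by
  funext α
  rw [← coeff_polyOf w, h, coeff_polyOf]

lemma polyOf_smul {t Δ : ℕ} (c : ℂ) (w : (Fin t → Fin (Δ + 1)) → ℂ) : polyOf (c • w) = c • polyOf w := by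
  unfold polyOf
  rw [Finset.smul_sum]
  refine Finset.sum_congr rfl fun α _ => ?_
  rw [smul_monomial]; rfl

lemma polyOf_deg {t Δ : ℕ} (w : (Fin t → Fin (Δ + 1)) → ℂ)
    (hw : ∀ α : Fin t → Fin (Δ + 1), Δ < ∑ i, (α i : ℕ) → w α = 0) : (polyOf w).totalDegree ≤ Δ := by
  unfold polyOf
  refine totalDegree_finsetSum_le fun α _ => ?_
  by_cases h : w α = 0
  · simp [h]
  · rw [totalDegree_monomial _ h, Finsupp.sum_fintype _ _ (by simp)]
    by_contra hcon
    push Not at hcon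
    exact h (hw α (by simpa [expo] using hcon))

noncomputable def ellP {t Δ : ℕ} (y : Fin t → ℂ) : MvPolynomial (Fin t → Fin (Δ + 1)) ℂ :=
  ∑ α, C (∏ i : Fin t, y i ^ (α i : ℕ)) * X α

lemma eval_ellP {t Δ : ℕ} (w : (Fin t → Fin (Δ + 1)) → ℂ) (y : Fin t → ℂ) :
    eval w (ellP y) = evalVec w y := by
  unfold ellP evalVec
  rw [map_sum]
  refine Finset.sum_congr rfl fun α _ => ?_
  rw [map_mul, eval_C, eval_X, mul_comm]

lemma ellP_deg {t Δ : ℕ} (y : Fin t → ℂ) : (ellP (Δ := Δ) y).totalDegree ≤ 1 := by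
  unfold ellP
  refine totalDegree_finsetSum_le fun α _ => (totalDegree_mul _ _).trans ?_
  rw [totalDegree_C, totalDegree_X]

def ptC {t : ℕ} {M : Finset ℚ} (y : Fin t → {x : ℚ // x ∈ M}) : Fin t → ℂ := fun j => ((y j : ℚ) : ℂ)

lemma ptC_inj {t : ℕ} {M : Finset ℚ} : Function.Injective (ptC (t := t) (M := M)) := by
  intro a b h
  funext i
  have := congrFun h i
  simp [ptC] at this
  exact this

def VV {σ : Type} (P : Ideal (MvPolynomial σ ℂ)) : Set (σ → ℂ) := {w | ∀ f ∈ P, eval w f = 0}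

open Classical in
noncomputable def bad {t Δ : ℕ} (M : Finset ℚ) (P : Ideal (MvPolynomial (Fin t → Fin (Δ + 1)) ℂ)) (m : ℕ) :
    Finset (Fin m → Fin t → {x : ℚ // x ∈ M}) :=
  Finset.univ.filter fun γ => ∃ w ∈ VV P, w ≠ 0 ∧ ∀ i, evalVec w (ptC (γ i)) = 0

lemma VV_cut {σ : Type} (P : Ideal (MvPolynomial σ ℂ)) (f : MvPolynomial σ ℂ) (w : σ → ℂ) (hw : w ∈ VV P)
    (hf : eval w f = 0) : ∃ Q ∈ (P ⊔ Ideal.span {f}).minimalPrimes, w ∈ VV Q := by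
  have hp : (RingHom.ker (eval w)).IsPrime := RingHom.ker_isPrime _
  have hle : P ⊔ Ideal.span {f} ≤ RingHom.ker (eval w) := by
    refine sup_le (fun g hg => hw g hg) ?_
    rw [Ideal.span_singleton_le_iff_mem]
    exact hf
  obtain ⟨Q, hQ, hQle⟩ := Ideal.exists_minimalPrimes_le hle
  exact ⟨Q, hQ, fun g hg => hQle hg⟩


lemma zcount_one {t Δ : ℕ} (ht : 1 ≤ t) (M : Finset ℚ) (hM : 1 ≤ M.card) (w : (Fin t → Fin (Δ + 1)) → ℂ)
    (hw : ∀ α : Fin t → Fin (Δ + 1), Δ < ∑ i, (α i : ℕ) → w α = 0) (h0 : w ≠ 0)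
    (Z : Finset (Fin t → {x : ℚ // x ∈ M})) (hZ : ∀ y ∈ Z, evalVec w (ptC y) = 0) :
    Z.card ≤ Δ * M.card ^ (t - 1) := by
  classical
  have hN : (M.image (fun q : ℚ => (q : ℂ))).card = M.card := 
    Finset.card_image_of_injective _ Rat.cast_injective
  have := zeros_one (Δ := Δ) (M.image (fun q : ℚ => (q : ℂ))) (Z.image ptC) (by
    intro y hy i
    obtain ⟨y', _, rfl⟩ := Finset.mem_image.1 hy
    exact Finset.mem_image_of_mem _ (y' i).2) (polyOf w) 
    (fun h => h0 (polyOf_inj _ _ (by rw [h]; simp [polyOf]))) (polyOf_deg w hw) (by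
    intro y hy
    obtain ⟨y', hy', rfl⟩ := Finset.mem_image.1 hy
    rw [eval_polyOf]; exact hZ y' hy')
  rw [hN, Finset.card_image_of_injective _ ptC_inj] at this
  refine Nat.le_of_mul_le_mul_right ?_ (show 0 < M.card by omega)
  rw [mul_assoc, ← pow_succ, Nat.sub_add_cancel ht]
  exact this

lemma zcount_two {t Δ : ℕ} (ht : 1 ≤ t) (hΔ : 1 ≤ Δ) (M : Finset ℚ) (hM : Δ + 1 ≤ M.card) (w w' : (Fin t → Fin (Δ + 1)) → ℂ)
    (hw : ∀ α : Fin t → Fin (Δ + 1), Δ < ∑ i, (α i : ℕ) → w α = 0) (h0 : w ≠ 0)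
    (hw' : ∀ α : Fin t → Fin (Δ + 1), Δ < ∑ i, (α i : ℕ) → w' α = 0) (h0' : ∀ c : ℂ, w' ≠ c • w)
    (Z : Finset (Fin t → {x : ℚ // x ∈ M})) (hZ : ∀ y ∈ Z, evalVec w (ptC y) = 0) 
    (hZ' : ∀ y ∈ Z, evalVec w' (ptC y) = 0) :
    M.card * Z.card + M.card ^ t ≤ (M.card + 1) * (Δ * M.card ^ (t - 1)) := by
  classical
  have hN : (M.image (fun q : ℚ => (q : ℂ))).card = M.card := 
    Finset.card_image_of_injective _ Rat.cast_injective
  have := zeros_two (Δ := Δ) hΔ (M.image (fun q : ℚ => (q : ℂ))) (by rw [hN]; exact hM) (Z.image ptC) (by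
    intro y hy i
    obtain ⟨y', _, rfl⟩ := Finset.mem_image.1 hy
    exact Finset.mem_image_of_mem _ (y' i).2) (polyOf w) (polyOf w')
    (fun h => h0 (polyOf_inj _ _ (by rw [h]; simp [polyOf]))) 
    (fun c h => h0' c (polyOf_inj _ _ (by rw [h, polyOf_smul]))) (polyOf_deg w hw) (polyOf_deg w' hw') (by
    intro y hy
    obtain ⟨y', hy', rfl⟩ := Finset.mem_image.1 hy
    rw [eval_polyOf]; exact hZ y' hy') (by
    intro y hy
    obtain ⟨y', hy', rfl⟩ := Finset.mem_image.1 hy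
    rw [eval_polyOf]; exact hZ' y' hy')
  rw [hN, Finset.card_image_of_injective _ ptC_inj] at this
  refine Nat.le_of_mul_le_mul_right ?_ (show 0 < M.card by omega)
  obtain ⟨s, rfl⟩ : ∃ s, t = s + 1 := ⟨t - 1, by omega⟩
  obtain ⟨d, rfl⟩ : ∃ d, Δ = d + 1 := ⟨Δ - 1, by omega⟩
  simp only [Nat.add_sub_cancel] at this ⊢
  calc _ = Z.card * M.card ^ 2 + M.card ^ (s + 1) * M.card := by ring
    _ ≤ (d * M.card + 1) * M.card ^ (s + 1) + M.card ^ (s + 1) * M.card := by omega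
    _ ≤ (d * M.card + 1) * M.card ^ (s + 1) + M.card ^ (s + 1) * M.card + d * M.card ^ (s+1) := Nat.le_add_right _ _
    _ = _ := by ring

lemma mem_bad {t Δ : ℕ} (M : Finset ℚ) (P : Ideal (MvPolynomial (Fin t → Fin (Δ + 1)) ℂ)) (m : ℕ)
    (γ : Fin m → Fin t → {x : ℚ // x ∈ M}) :
    γ ∈ bad M P m ↔ ∃ w ∈ VV P, w ≠ 0 ∧ ∀ i, evalVec w (ptC (γ i)) = 0 := by
  classical
  unfold bad
  simp

lemma VV_supp {t Δ : ℕ} (P : Ideal (MvPolynomial (Fin t → Fin (Δ + 1)) ℂ))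
    (hs : ∀ α : Fin t → Fin (Δ + 1), Δ < ∑ i, (α i : ℕ) → X α ∈ P) (w) (hw : w ∈ VV P) :
    ∀ α : Fin t → Fin (Δ + 1), Δ < ∑ i, (α i : ℕ) → w α = 0 := by
  intro α h
  simpa using hw _ (hs α h)

lemma evalVec_smul {t Δ : ℕ} (c : ℂ) (w : (Fin t → Fin (Δ + 1)) → ℂ) (y) :
    evalVec (c • w) y = c * evalVec w y := by
  unfold evalVec
  rw [Finset.mul_sum]
  refine Finset.sum_congr rfl fun α _ => ?_
  simp [mul_assoc]

lemma bad_fiber {t Δ : ℕ} (M : Finset ℚ) (P : Ideal (MvPolynomial (Fin t → Fin (Δ + 1)) ℂ)) (m : ℕ) (y) :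
    (((bad M P (m+1)).filter fun γ => γ 0 = y).card ≤ (bad M P m).card) ∧
    ∀ T : Finset (Ideal (MvPolynomial (Fin t → Fin (Δ + 1)) ℂ)), 
      (∀ Q ∈ (P ⊔ Ideal.span {ellP (ptC y)}).minimalPrimes, Q ∈ T) →
    ((bad M P (m+1)).filter fun γ => γ 0 = y).card ≤ ∑ Q ∈ T, (bad M Q m).card := by
  classical
  have hinj : Set.InjOn (Fin.tail : (Fin (m+1) → Fin t → {x : ℚ // x ∈ M}) → _)
      ((bad M P (m+1)).filter fun γ => γ 0 = y : Finset _) := by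
    intro a ha b hb h
    simp only [Finset.coe_filter, Set.mem_setOf_eq] at ha hb
    rw [← Fin.cons_self_tail a, ← Fin.cons_self_tail b, ha.2, hb.2, h]
  constructor
  · refine Finset.card_le_card_of_injOn Fin.tail ?_ hinj
    intro γ hγ
    simp only [Finset.coe_filter, Set.mem_setOf_eq] at hγ
    obtain ⟨w, hw, h0, h⟩ := (mem_bad _ _ _ _).1 hγ.1
    exact (mem_bad _ _ _ _).2 ⟨w, hw, h0, fun i => h i.succ⟩
  · intro T hT
    refine le_trans (Finset.card_le_card_of_injOn (t := T.biUnion fun Q => bad M Q m) Fin.tail ?_ hinj)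
      Finset.card_biUnion_le
    intro γ hγ
    simp only [Finset.coe_filter, Set.mem_setOf_eq] at hγ
    obtain ⟨w, hw, h0, h⟩ := (mem_bad _ _ _ _).1 hγ.1
    obtain ⟨Q, hQ, hwQ⟩ := VV_cut P (ellP (ptC y)) w hw (by rw [eval_ellP, ← hγ.2]; exact h 0)
    simp only [Finset.coe_biUnion, Set.mem_iUnion]
    exact ⟨Q, hT Q hQ, (mem_bad _ _ _ _).2 ⟨w, hwQ, h0, fun i => h i.succ⟩⟩

lemma card_fib {m : ℕ} {β : Type} [Fintype β] (S : Finset (Fin (m+1) → β)) 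
    [i : ∀ y, DecidablePred fun γ : Fin (m+1) → β => γ 0 = y] : 
    S.card = ∑ y, (S.filter fun γ => γ 0 = y).card := by
  classical
  rw [Finset.card_eq_sum_card_fiberwise (s := S) (f := fun γ => γ 0) (t := Finset.univ) 
    (fun _ _ => Finset.mem_coe.2 (Finset.mem_univ _))]
  refine Finset.sum_congr rfl fun y _ => ?_
  congr

lemma bad_count {t Δ : ℕ} (ht : 1 ≤ t) (hΔ : 1 ≤ Δ) (M : Finset ℚ) (hM : Δ + 1 ≤ M.card) (m : ℕ) :
    ∀ (P : Ideal (MvPolynomial (Fin t → Fin (Δ + 1)) ℂ)) (_ : P.IsPrime)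
    (hs : ∀ α : Fin t → Fin (Δ + 1), Δ < ∑ i, (α i : ℕ) → X α ∈ P),
    ((bad M P m).card : ℝ≥0∞) ≤ ((Δ * M.card ^ (t - 1) : ℕ) : ℝ≥0∞) ^ m * (pdeg P * ((M.card : ℝ≥0∞) + 1) ^ (pdim P)) := by
  classical
  have hone : ∀ (P : Ideal (MvPolynomial (Fin t → Fin (Δ + 1)) ℂ)) (_ : P.IsPrime), 
      1 ≤ pdeg P * ((M.card : ℝ≥0∞) + 1) ^ (pdim P) := by
    intro P hP
    exact one_le_mul (one_le_pdeg P) (one_le_pow₀ (by simp))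
  induction m with
  | zero =>
    intro P hP hs
    rw [pow_zero, one_mul]
    refine le_trans ?_ (hone P hP)
    have : (bad M P 0).card ≤ 1 := (Finset.card_le_univ _).trans (by simp)
    exact_mod_cast this
  | succ m ih =>
    intro P hP hs
    by_cases hex : ∃ w0 ∈ VV P, w0 ≠ 0
    swap
    · have : bad M P (m+1) = ∅ := by
        ext γ
        rw [mem_bad]
        push Not at hex
        simp only [Finset.notMem_empty, iff_false]
        rintro ⟨w, hw, h0, _⟩
        exact h0 (hex w hw)
      rw [this]; simp
    obtain ⟨w0, hw0, h0⟩ := hex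
    by_cases hline : ∀ w ∈ VV P, ∃ c : ℂ, w = c • w0
    · have hsub : bad M P (m+1) ⊆ Fintype.piFinset fun _ : Fin (m+1) => 
          Finset.univ.filter fun y : Fin t → {x : ℚ // x ∈ M} => evalVec w0 (ptC y) = 0 := by
        intro γ hγ
        obtain ⟨w, hw, hw1, h⟩ := (mem_bad _ _ _ _).1 hγ
        obtain ⟨c, rfl⟩ := hline w hw
        rw [Fintype.mem_piFinset]
        intro i
        simp only [Finset.mem_filter, Finset.mem_univ, true_and]
        have := h i
        rw [evalVec_smul] at this
        rcases mul_eq_zero.1 this with h | h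
        · exact absurd (by rw [h, zero_smul]) hw1
        · exact h
      have hc := Finset.card_le_card hsub
      rw [Fintype.card_piFinset_const] at hc
      have hz := zcount_one ht M (by omega) w0 (VV_supp P hs w0 hw0) h0
        (Finset.univ.filter fun y : Fin t → {x : ℚ // x ∈ M} => evalVec w0 (ptC y) = 0) (by simp)
      have := hc.trans (Nat.pow_le_pow_left hz (m+1))
      calc ((bad M P (m+1)).card : ℝ≥0∞) ≤ ((Δ * M.card ^ (t - 1) : ℕ) : ℝ≥0∞) ^ (m+1) * 1 := by
            rw [mul_one]; exact_mod_cast this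
        _ ≤ _ := by gcongr; exact hone P hP
    · push Not at hline
      obtain ⟨w1, hw1, hl⟩ := hline
      set E : ℝ≥0∞ := ((Δ * M.card ^ (t - 1) : ℕ) : ℝ≥0∞) with hE
      set Φ : ℝ≥0∞ := pdeg P * ((M.card : ℝ≥0∞) + 1) ^ (pdim P) with hΦ
      set Y0 : Finset (Fin t → {x : ℚ // x ∈ M}) := Finset.univ.filter fun y => ellP (ptC y) ∈ P with hY0
      have hz := zcount_two ht hΔ M hM w0 w1 (VV_supp P hs w0 hw0) h0 (VV_supp P hs w1 hw1) hl Y0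
        (by
          intro y hy
          rw [← eval_ellP]
          exact hw0 _ (Finset.mem_filter.1 hy).2)
        (by
          intro y hy
          rw [← eval_ellP]
          exact hw1 _ (Finset.mem_filter.1 hy).2)
      have hfib : ∀ y, ((M.card : ℝ≥0∞) + 1) * (((bad M P (m+1)).filter fun γ => γ 0 = y).card : ℝ≥0∞) ≤
          E ^ m * Φ * (1 + (M.card : ℝ≥0∞) * (if y ∈ Y0 then 1 else 0)) := by
        intro y
        by_cases hy : ellP (ptC y) ∈ P
        · have hyY : y ∈ Y0 := by simp [hY0, hy]
          rw [if_pos hyY, mul_one, mul_comm, add_comm (1 : ℝ≥0∞)]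
          gcongr
          refine le_trans ?_ (ih P hP hs)
          exact_mod_cast (bad_fiber M P m y).1
        · have hyY : y ∉ Y0 := by simp [hY0, hy]
          rw [if_neg hyY, mul_zero, add_zero, mul_one]
          have hfin := Ideal.finite_minimalPrimes_of_isNoetherianRing 
            (MvPolynomial (Fin t → Fin (Δ + 1)) ℂ) (P ⊔ Ideal.span {ellP (ptC y)})
          have hT : ∀ Q ∈ hfin.toFinset, Q ∈ (P ⊔ Ideal.span {ellP (ptC y)}).minimalPrimes := by
            intro Q hQ; simpa using hQ
          have hb := (bad_fiber M P m y).2 hfin.toFinset (by intro Q hQ; simpa using hQ)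
          calc ((M.card : ℝ≥0∞) + 1) * (((bad M P (m+1)).filter fun γ => γ 0 = y).card : ℝ≥0∞)
              ≤ ((M.card : ℝ≥0∞) + 1) * ∑ Q ∈ hfin.toFinset, ((bad M Q m).card : ℝ≥0∞) := by
                gcongr; exact_mod_cast hb
            _ = ∑ Q ∈ hfin.toFinset, ((M.card : ℝ≥0∞) + 1) * ((bad M Q m).card : ℝ≥0∞) := by
                rw [Finset.mul_sum]
            _ ≤ ∑ Q ∈ hfin.toFinset, E ^ m * ((M.card : ℝ≥0∞) + 1) ^ (pdim P) * pdeg Q := by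
                refine Finset.sum_le_sum fun Q hQ => ?_
                have hQ' := hT Q hQ
                have hPQ : P ≤ Q := le_sup_left.trans hQ'.1.2
                have := ih Q hQ'.1.1 (fun α hα => hPQ (hs α hα))
                calc _ ≤ ((M.card : ℝ≥0∞) + 1) * (E ^ m * (pdeg Q * ((M.card : ℝ≥0∞) + 1) ^ (pdim Q))) := by
                      gcongr
                  _ = _ := by
                    rw [← pdim_cut P _ hy Q hQ', pow_succ]; ring
            _ = E ^ m * ((M.card : ℝ≥0∞) + 1) ^ (pdim P) * ∑ Q ∈ hfin.toFinset, pdeg Q := by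
                rw [Finset.mul_sum]
            _ ≤ E ^ m * ((M.card : ℝ≥0∞) + 1) ^ (pdim P) * pdeg P := by
                gcongr; exact pdeg_cut P _ hy (ellP_deg _) _ hT
            _ = E ^ m * Φ := by rw [hΦ]; ring
      have hcard : (bad M P (m+1)).card = ∑ y, ((bad M P (m+1)).filter fun γ => γ 0 = y).card :=
        card_fib _
      have hne0 : ((M.card : ℝ≥0∞) + 1) ≠ 0 := by simp
      have hnet : ((M.card : ℝ≥0∞) + 1) ≠ ⊤ := by simp
      rw [← ENNReal.mul_le_mul_iff_right hne0 hnet]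
      calc ((M.card : ℝ≥0∞) + 1) * ((bad M P (m+1)).card : ℝ≥0∞) 
          = ∑ y, ((M.card : ℝ≥0∞) + 1) * (((bad M P (m+1)).filter fun γ => γ 0 = y).card : ℝ≥0∞) := by
            rw [hcard, Nat.cast_sum, Finset.mul_sum]
        _ ≤ ∑ y, E ^ m * Φ * (1 + (M.card : ℝ≥0∞) * (if y ∈ Y0 then 1 else 0)) := 
            Finset.sum_le_sum fun y _ => hfib y
        _ = E ^ m * Φ * ((M.card * Y0.card + M.card ^ t : ℕ) : ℝ≥0∞) := by
            rw [← Finset.mul_sum, Finset.sum_add_distrib, ← Finset.mul_sum]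
            simp
            ring
        _ ≤ E ^ m * Φ * (((M.card + 1) * (Δ * M.card ^ (t - 1)) : ℕ) : ℝ≥0∞) := by
            gcongr
        _ = _ := by
            rw [Nat.cast_mul (M.card + 1), ← hE]; push_cast; ring

lemma mem_zClosure {ι : Type} (S : Set (ι → ℂ)) (v : ι → ℂ) :
    v ∈ zClosure S ↔ ∀ f : MvPolynomial ι ℂ, (∀ x ∈ S, eval x f = 0) → eval v f = 0 := by
  constructor
  · intro h f hf
    have := h {x | ∀ g ∈ ({f} : Set (MvPolynomial ι ℂ)), eval x g = 0} ⟨⟨{f}, rfl⟩, by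
      intro x hx g hg
      rw [Set.mem_singleton_iff.1 hg]; exact hf x hx⟩
    exact this f rfl
  · rintro h C ⟨⟨F, rfl⟩, hS⟩ f hf
    exact h f fun x hx => hS hx f hf

noncomputable def psiP {σ : Type} {L : ℕ} (Ω : σ → MvPolynomial (Fin L) ℚ) :
    MvPolynomial σ ℂ →ₐ[ℂ] MvPolynomial (Fin L ⊕ Fin L) ℂ :=
  aeval fun α => rename Sum.inl (map (algebraMap ℚ ℂ) (Ω α)) - rename Sum.inr (map (algebraMap ℚ ℂ) (Ω α))

lemma eval_psiP {σ : Type} {L : ℕ} (Ω : σ → MvPolynomial (Fin L) ℚ) (f : MvPolynomial σ ℂ) (c c' : Fin L → ℂ) :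
    eval (Sum.elim c c') (psiP Ω f) = eval (fun α => aeval c (Ω α) - aeval c' (Ω α)) f := by
  induction f using MvPolynomial.induction_on with
  | C a => simp [psiP]
  | add p q hp hq => simp only [map_add, hp, hq]
  | mul_X p i hp => 
    simp only [map_mul, hp]
    congr 1
    simp [psiP, eval_rename, eval_map, aeval_def, Function.comp_def]

lemma diff_mem {t L Δ : ℕ} (D : Set (Fin L → ℂ)) (Ω : (Fin t → Fin (Δ + 1)) → MvPolynomial (Fin L) ℚ)
    (F G) (hF : F ∈ zClosure (objClass t L Δ D Ω)) (hG : G ∈ zClosure (objClass t L Δ D Ω)) :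
    F - G ∈ VV (RingHom.ker (psiP Ω)) := by
  intro f hf
  have hf' : psiP Ω f = 0 := hf
  have key : ∀ (a b : (Fin t → Fin (Δ + 1)) → ℂ), eval a (bind₁ (fun α => X α - C (b α)) f) = eval (a - b) f := by
    intro a b
    rw [← coe_aeval_eq_eval, ← coe_aeval_eq_eval]
    simp only [RingHom.coe_coe]
    rw [aeval_bind₁]
    congr 2
    funext α; simp
  have key2 : ∀ (a b : (Fin t → Fin (Δ + 1)) → ℂ), eval b (bind₁ (fun α => C (a α) - X α) f) = eval (a - b) f := by
    intro a b
    rw [← coe_aeval_eq_eval, ← coe_aeval_eq_eval]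
    simp only [RingHom.coe_coe]
    rw [aeval_bind₁]
    congr 2
    funext α; simp
  rw [← key2]
  refine (mem_zClosure _ _).1 hG _ ?_
  rintro _ ⟨c', _, rfl⟩
  rw [key2, ← key]
  refine (mem_zClosure _ _).1 hF _ ?_
  rintro _ ⟨c, _, rfl⟩
  rw [key]
  have := eval_psiP Ω f c c'
  rw [hf', map_zero] at this
  exact this.symm

lemma evalVec_sub {t Δ : ℕ} (v w : (Fin t → Fin (Δ + 1)) → ℂ) (y) :
    evalVec (v - w) y = evalVec v y - evalVec w y := by
  unfold evalVec
  rw [← Finset.sum_sub_distrib]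
  refine Finset.sum_congr rfl fun α _ => ?_
  simp [sub_mul]

lemma notinj_bad {t L Δ m : ℕ} (D : Set (Fin L → ℂ)) (Ω : (Fin t → Fin (Δ + 1)) → MvPolynomial (Fin L) ℚ)
    (M : Finset ℚ) (γ : Fin m → Fin t → {x : ℚ // x ∈ M})
    (h : ¬ Set.InjOn (fun v => fun i : Fin m => evalVec v (fun j => ((γ i j : ℚ) : ℂ)))
              (zClosure (objClass t L Δ D Ω))) : γ ∈ bad M (RingHom.ker (psiP Ω)) m := by
  rw [mem_bad]
  unfold Set.InjOn at h
  push Not at h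
  obtain ⟨F, hF, G, hG, he, hne⟩ := h
  refine ⟨F - G, diff_mem D Ω F G hF hG, sub_ne_zero.2 hne, fun i => ?_⟩
  rw [evalVec_sub, sub_eq_zero]
  exact congrFun he i

lemma numeric (t L Δ Δ2 m N : ℕ) (ht : 1 ≤ t) (hΔ : 1 ≤ Δ) (hm : 4 * L + 2 ≤ m) 
    (hN : Δ ^ 2 * Δ2 + 1 ≤ N) (hΔ2 : 1 ≤ Δ2) :
    (Δ * N ^ (t - 1)) ^ m * (Δ2 * (N + 1)) ^ (2 * L) ≤ N ^ (m * t - 1) := by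
  have h1 : Δ ^ 2 ≤ N := le_trans (le_trans (Nat.le_mul_of_pos_right _ hΔ2) (Nat.le_succ _)) hN
  have h2 : Δ ^ 2 * (Δ2 * (N + 1)) ≤ N ^ 2 := by
    obtain ⟨k, rfl⟩ : ∃ k, N = k + 1 := ⟨N - 1, by omega⟩
    have : Δ ^ 2 * Δ2 ≤ k := by omega
    nlinarith
  have h3 : Δ ^ m * (Δ2 * (N + 1)) ^ (2 * L) ≤ N ^ (m - 1) := by
    obtain ⟨r, rfl⟩ : ∃ r, m = 4 * L + (r + 2) := ⟨m - (4 * L + 2), by omega⟩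
    have e : 4 * L + (r + 2) - 1 = 4 * L + (r + 1) := by omega
    have hΔN : Δ ≤ N := le_trans (by nlinarith) h1
    rw [e]
    calc _ = (Δ ^ 2 * (Δ2 * (N + 1))) ^ (2 * L) * (Δ ^ 2 * Δ ^ r) := by
          rw [mul_pow (Δ ^ 2), ← pow_mul]; ring
      _ ≤ (N ^ 2) ^ (2 * L) * (N * N ^ r) := 
          Nat.mul_le_mul (Nat.pow_le_pow_left h2 _) (Nat.mul_le_mul h1 (Nat.pow_le_pow_left hΔN _))
      _ = _ := by rw [← pow_mul]; ring
  obtain ⟨s, rfl⟩ : ∃ s, t = s + 1 := ⟨t - 1, by omega⟩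
  have h4 : m * (s + 1) - 1 = s * m + (m - 1) := by
    have : m * (s + 1) = s * m + m := by ring
    omega
  rw [h4, pow_add, Nat.add_sub_cancel, mul_pow, ← pow_mul]
  calc _ = N ^ (s * m) * (Δ ^ m * (Δ2 * (N + 1)) ^ (2 * L)) := by ring
    _ ≤ _ := Nat.mul_le_mul_left _ h3

lemma bad_final {t L Δ Δ2 m : ℕ} (ht : 1 ≤ t) (hΔ : 1 ≤ Δ) (hΔ2 : 1 ≤ Δ2)
    (hm : 4 * L + 2 ≤ m)
    (Ω : (Fin t → Fin (Δ + 1)) → MvPolynomial (Fin L) ℚ)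
    (hΩdeg : ∀ α, (Ω α).totalDegree ≤ Δ2)
    (hΩsupp : ∀ α : Fin t → Fin (Δ + 1), Δ < ∑ i : Fin t, (α i : ℕ) → Ω α = 0)
    (M : Finset ℚ) (hM : Δ ^ 2 * Δ2 + 1 ≤ M.card) :
    (bad M (RingHom.ker (psiP Ω)) m).card ≤ M.card ^ (m * t - 1) := by
  have h1 : Δ + 1 ≤ M.card := by nlinarith
  have hdeg : ∀ i, (psiP Ω (X i)).totalDegree ≤ Δ2 := by
    intro α
    unfold psiP
    rw [aeval_X]
    refine (totalDegree_sub _ _).trans (max_le ?_ ?_) <;>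
    exact (totalDegree_rename_le _ _).trans ((Finset.sup_mono (support_map_subset _ _)).trans (hΩdeg α))
  have hP : (RingHom.ker (psiP Ω)).IsPrime := RingHom.ker_isPrime _
  have hb := bad_count ht hΔ M h1 m _ hP (by
    intro α hα
    rw [RingHom.mem_ker]
    simp [psiP, hΩsupp α hα])
  obtain ⟨hd, hg⟩ := pdeg_image (psiP Ω) Δ2 hΔ2 hdeg
  have hd' : pdim (RingHom.ker (psiP Ω)) ≤ 2 * L := by
    refine hd.trans ?_
    simp; omega
  have : ((bad M (RingHom.ker (psiP Ω)) m).card : ℝ≥0∞) ≤ 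
      (((Δ * M.card ^ (t - 1)) ^ m * (Δ2 * (M.card + 1)) ^ (2 * L) : ℕ) : ℝ≥0∞) := by
    refine hb.trans ?_
    calc _ ≤ ((Δ * M.card ^ (t - 1) : ℕ) : ℝ≥0∞) ^ m * ((Δ2 : ℝ≥0∞) ^ (pdim (RingHom.ker (psiP Ω)))
         * ((M.card : ℝ≥0∞) + 1) ^ (pdim (RingHom.ker (psiP Ω)))) := by gcongr
      _ = ((Δ * M.card ^ (t - 1) : ℕ) : ℝ≥0∞) ^ m * (((Δ2 * (M.card + 1) : ℕ) : ℝ≥0∞) ^ (pdim (RingHom.ker (psiP Ω)))) := by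
        rw [← mul_pow]; push_cast; rfl
      _ ≤ ((Δ * M.card ^ (t - 1) : ℕ) : ℝ≥0∞) ^ m * (((Δ2 * (M.card + 1) : ℕ) : ℝ≥0∞) ^ (2 * L)) := by
        gcongr
        · exact_mod_cast Nat.mul_pos hΔ2 (Nat.succ_pos _)
      _ = _ := by push_cast; rfl
  have h2 : (bad M (RingHom.ker (psiP Ω)) m).card ≤ (Δ * M.card ^ (t - 1)) ^ m * (Δ2 * (M.card + 1)) ^ (2 * L) := by
    exact_mod_cast this
  exact h2.trans (numeric t L Δ Δ2 m M.card ht hΔ hm hM hΔ2)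

lemma M_big (L K Δ Δ1 Δ2 N : ℕ) (hL : 1 ≤ L) (hΔ : 1 ≤ Δ) (hΔ2 : 1 ≤ Δ2) (h : (Δ : ℝ) ^ 2 * ((L : ℝ) + 1) ^ ((1 : ℝ) / (L : ℝ)) *
        (1 + (K : ℝ) * (Δ1 : ℝ)) * (Δ2 : ℝ) ≤ (N : ℝ)) : Δ ^ 2 * Δ2 + 1 ≤ N := by
  have hL' : (0:ℝ) < L := by exact_mod_cast hL
  have hΔ' : (0:ℝ) < Δ := by exact_mod_cast hΔ
  have hΔ2' : (0:ℝ) < Δ2 := by exact_mod_cast hΔ2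
  have h1 : 1 < ((L : ℝ) + 1) ^ ((1 : ℝ) / (L : ℝ)) := Real.one_lt_rpow (by linarith) (by positivity)
  have h2 : (1:ℝ) ≤ 1 + (K : ℝ) * (Δ1 : ℝ) := by
    have : (0:ℝ) ≤ (K : ℝ) * (Δ1 : ℝ) := by positivity
    linarith
  have h3 : 1 < ((L : ℝ) + 1) ^ ((1 : ℝ) / (L : ℝ)) * (1 + (K : ℝ) * (Δ1 : ℝ)) := one_lt_mul_of_lt_of_le h1 h2
  have h4 : ((Δ ^ 2 * Δ2 : ℕ) : ℝ) < N := by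
    push_cast
    refine lt_of_lt_of_le ?_ h
    have : (0:ℝ) < (Δ:ℝ) ^ 2 * Δ2 := by positivity
    nlinarith
  exact_mod_cast h4

lemma homogComp_mul {σ : Type} (p q : MvPolynomial σ ℂ) (n : ℕ) (hq : q.IsHomogeneous 1) :
    homogeneousComponent (n+1) (p*q) = homogeneousComponent n p * q := by
  conv_lhs => rw [← sum_homogeneousComponent p, Finset.sum_mul, map_sum]
  have : ∀ i, homogeneousComponent (n+1) (homogeneousComponent i p * q) = 
      if n = i then homogeneousComponent i p * q else 0 := by
    intro i
    rw [homogeneousComponent_of_mem (n := i + 1) 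
      ((homogeneousComponent_isHomogeneous i p).mul hq)]
    simp
  simp only [this]
  rw [Finset.sum_ite_eq]
  split_ifs with h
  · rfl
  · rw [homogeneousComponent_eq_zero, zero_mul]
    simpa using h

lemma eval_smul_homog {σ : Type} (p : MvPolynomial σ ℂ) (n : ℕ) (hp : p.IsHomogeneous n) (s : ℂ) (x : σ → ℂ) :
    eval (s • x) p = s ^ n * eval x p := by
  rw [eval_eq, eval_eq, Finset.mul_sum]
  refine Finset.sum_congr rfl fun d hd => ?_
  have h1 : d.degree = n := by
    have := hp (mem_support_iff.1 hd)
    rw [← this]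
    exact congrFun (congrArg DFunLike.coe Finsupp.degree_eq_weight_one) _
  have h2 : ∏ i ∈ d.support, (s • x) i ^ d i = s ^ n * ∏ i ∈ d.support, x i ^ d i := by
    simp only [Pi.smul_apply, smul_eq_mul, mul_pow]
    rw [Finset.prod_mul_distrib, Finset.prod_pow_eq_pow_sum]
    congr 2
  rw [h2]; ring

lemma vanish_homog {σ : Type} (S : Set (σ → ℂ)) (hS : IsCone S) (f : MvPolynomial σ ℂ)
    (hf : ∀ x ∈ S, eval x f = 0) (n : ℕ) : ∀ x ∈ S, eval x (homogeneousComponent n f) = 0 := by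
  intro x hx
  let q : Polynomial ℂ := ∑ i ∈ Finset.range (f.totalDegree + 1), 
    Polynomial.monomial i (eval x (homogeneousComponent i f))
  have hq : q = 0 := by
    refine Polynomial.funext fun s => ?_
    have := hf _ (hS s x hx)
    rw [← sum_homogeneousComponent f, map_sum] at this
    simp only [q, Polynomial.eval_finset_sum, Polynomial.eval_monomial, Polynomial.eval_zero]
    rw [← this]
    refine Finset.sum_congr rfl fun i _ => ?_
    rw [eval_smul_homog _ i (homogeneousComponent_isHomogeneous i f), mul_comm]
  by_cases h : n < f.totalDegree + 1
  · have h1 := congrArg (fun p => p.coeff n) hq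
    simp only [q, Polynomial.finset_sum_coeff, Polynomial.coeff_monomial, Polynomial.coeff_zero] at h1
    rw [Finset.sum_ite_eq' ] at h1
    simpa [h] using h1
  · rw [homogeneousComponent_eq_zero _ _ (by omega), map_zero]

lemma rel_exists {σ : Type} [Fintype σ] {m : ℕ} (S : Set (σ → ℂ)) (hS : IsCone S) 
    (hcl : ∀ x, (∀ f, (∀ y ∈ S, eval y f = 0) → eval x f = 0) → x ∈ S)
    (ℓ : Fin m → MvPolynomial σ ℂ) (hℓ : ∀ j, (ℓ j).IsHomogeneous 1)
    (h0 : ∀ x ∈ S, (∀ j, eval x (ℓ j) = 0) → x = 0) (a : σ) :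
    ∃ (n : ℕ), ∀ N, n ≤ N → ∃ h : Fin m → MvPolynomial σ ℂ, (∀ j, (h j).IsHomogeneous N) ∧ 
      ∀ x ∈ S, eval x (X a ^ (N+1) - ∑ j, h j * ℓ j) = 0 := by
  have hrad : (X a : MvPolynomial σ ℂ) ∈ 
      (vanishingIdeal ℂ S ⊔ Ideal.span (Set.range ℓ)).radical := by
    rw [← vanishingIdeal_zeroLocus_eq_radical (K := ℂ)]
    rw [mem_vanishingIdeal_iff]
    intro x hx
    rw [mem_zeroLocus_iff] at hx
    have hxS : x ∈ S := hcl x fun f hf => by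
      have := hx f (Ideal.mem_sup_left (mem_vanishingIdeal_iff.2 (by simpa [aeval_eq_eval] using hf)))
      simpa [aeval_eq_eval] using this
    have : x = 0 := h0 x hxS fun j => by
      have := hx (ℓ j) (Ideal.mem_sup_right (Ideal.subset_span ⟨j, rfl⟩))
      simpa [aeval_eq_eval] using this
    simp [this]
  obtain ⟨n, hn⟩ := hrad
  refine ⟨n, fun N hN => ?_⟩
  have hN1 : (X a : MvPolynomial σ ℂ) ^ (N+1) ∈ vanishingIdeal ℂ S ⊔ Ideal.span (Set.range ℓ) := 
    Ideal.pow_mem_of_pow_mem _ hn (by omega)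
  obtain ⟨g, hg, z, hz, hgz⟩ := Submodule.mem_sup.1 hN1
  obtain ⟨c, rfl⟩ := Ideal.mem_span_range_iff_exists_fun.1 hz
  refine ⟨fun j => homogeneousComponent N (c j), fun j => homogeneousComponent_isHomogeneous _ _, ?_⟩
  have e : (X a : MvPolynomial σ ℂ) ^ (N+1) - ∑ j, homogeneousComponent N (c j) * ℓ j = homogeneousComponent (N+1) g := by
    have h1 : homogeneousComponent (N+1) ((X a : MvPolynomial σ ℂ) ^ (N+1)) = X a ^ (N+1) := by
      have := (isHomogeneous_X_pow (R := ℂ) a (N+1))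
      rw [homogeneousComponent_of_mem this, if_pos rfl]
    rw [← h1, ← hgz, map_add, map_sum]
    simp only [homogComp_mul _ _ N (hℓ _)]
    ring
  intro x hx
  rw [e]
  exact vanish_homog S hS g (by simpa [mem_vanishingIdeal_iff, aeval_eq_eval] using hg) _ x hx

lemma quot_integral {σ : Type} [Fintype σ] {m : ℕ} (J : Ideal (MvPolynomial σ ℂ)) 
    (ℓ : Fin m → MvPolynomial σ ℂ) (N : ℕ)
    (h : σ → Fin m → MvPolynomial σ ℂ) (hh : ∀ a j, (h a j).IsHomogeneous N)
    (hr : ∀ a, X a ^ (N+1) - ∑ j, h a j * ℓ j ∈ J) 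
    (S : Subalgebra ℂ (MvPolynomial σ ℂ ⧸ J)) (hS : ∀ j, Ideal.Quotient.mk J (ℓ j) ∈ S) :
    Algebra.IsIntegral S (MvPolynomial σ ℂ ⧸ J) := by
  classical
  let Dg : ℕ := Fintype.card σ * N + 1
  let B : Set (MvPolynomial σ ℂ ⧸ J) := 
    (fun d : σ →₀ ℕ => Ideal.Quotient.mk J (monomial d (1:ℂ))) '' {d | d.degree < Dg}
  have hB : B.Finite := by
    refine Set.Finite.image _ ?_
    exact (Finsupp.finite_of_degree_le (Dg)).subset fun d (hd : d.degree < Dg) => le_of_lt hd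
  let W : Submodule S (MvPolynomial σ ℂ ⧸ J) := Submodule.span S B
  have hCW : ∀ (c : ℂ) (x : MvPolynomial σ ℂ), Ideal.Quotient.mk J x ∈ W → Ideal.Quotient.mk J (C c * x) ∈ W := by
    intro c x hx
    have : Ideal.Quotient.mk J (C c * x) = (algebraMap ℂ S c) • Ideal.Quotient.mk J x := by
      rw [map_mul]; rfl
    rw [this]
    exact W.smul_mem _ hx
  have key : ∀ n, ∀ d : σ →₀ ℕ, d.degree = n → Ideal.Quotient.mk J (monomial d (1:ℂ)) ∈ W := by
    intro n
    induction n using Nat.strong_induction_on with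
    | _ n ih =>
      intro d hd
      by_cases hlt : n < Dg
      · exact Submodule.subset_span ⟨d, by simpa [hd] using hlt, rfl⟩
      · have hhom : ∀ p : MvPolynomial σ ℂ, p.IsHomogeneous (n-1) → Ideal.Quotient.mk J p ∈ W := by
          intro p hp
          rw [p.as_sum, map_sum]
          refine W.sum_mem fun e he => ?_
          have : monomial e (coeff e p) = C (coeff e p) * monomial e (1:ℂ) := by
            rw [C_mul_monomial, mul_one]
          rw [this]
          refine hCW _ _ (ih (n-1) (by omega) e ?_)
          have := hp (mem_support_iff.1 he)
          rw [← this]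
          exact congrFun (congrArg DFunLike.coe Finsupp.degree_eq_weight_one) _
        obtain ⟨a, ha⟩ : ∃ a, N + 1 ≤ d a := by
          by_contra hcon
          push Not at hcon
          have : d.degree ≤ Fintype.card σ * N := by
            rw [Finsupp.degree_eq_sum]
            calc _ ≤ ∑ a : σ, N := Finset.sum_le_sum fun a _ => by have := hcon a; omega
              _ = _ := by simp
          omega
        let e := d - Finsupp.single a (N+1)
        have hde : d = e + Finsupp.single a (N+1) := by
          rw [tsub_add_cancel_of_le]
          rw [Finsupp.single_le_iff]; exact ha
        have hedeg : e.degree + (N + 1) = n := by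
          rw [← hd, hde]; simp [map_add]
        have hmon : (monomial d (1:ℂ)) = monomial e (1:ℂ) * X a ^ (N+1) := by
          rw [X_pow_eq_monomial, monomial_mul, mul_one, ← hde]
        have : Ideal.Quotient.mk J (monomial d (1:ℂ)) = 
            ∑ j, (⟨Ideal.Quotient.mk J (ℓ j), hS j⟩ : S) • Ideal.Quotient.mk J (monomial e (1:ℂ) * h a j) := by
          have h1 : Ideal.Quotient.mk J (X a ^ (N+1)) = Ideal.Quotient.mk J (∑ j, h a j * ℓ j) :=
            Ideal.Quotient.eq.2 (hr a)
          rw [hmon, map_mul, h1, map_sum, Finset.mul_sum]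
          refine Finset.sum_congr rfl fun j _ => ?_
          rw [Subalgebra.smul_def, smul_eq_mul, map_mul, map_mul]
          ring
        rw [this]
        refine W.sum_mem fun j _ => W.smul_mem _ (hhom _ ?_)
        have := (isHomogeneous_monomial (1:ℂ) (rfl : e.degree = e.degree)).mul (hh a j)
        have e2 : e.degree + N = n - 1 := by omega
        rw [← e2]; exact this
  have htop : W = ⊤ := by
    rw [eq_top_iff]
    rintro x -
    obtain ⟨p, rfl⟩ := Ideal.Quotient.mk_surjective x
    rw [p.as_sum, map_sum]
    refine W.sum_mem fun e he => ?_
    have : monomial e (coeff e p) = C (coeff e p) * monomial e (1:ℂ) := by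
      rw [C_mul_monomial, mul_one]
    rw [this]
    exact hCW _ _ (key _ e rfl)
  have : Module.Finite S (MvPolynomial σ ℂ ⧸ J) := ⟨⟨hB.toFinset, by
    rw [hB.coe_toFinset]; exact htop⟩⟩
  exact Algebra.IsIntegral.of_finite _ _

lemma image_closed {σ : Type} [Fintype σ] {m : ℕ} (J : Ideal (MvPolynomial σ ℂ)) 
    (ℓ : Fin m → MvPolynomial σ ℂ) 
    (hint : Algebra.IsIntegral (aeval (R := ℂ) fun j => Ideal.Quotient.mk J (ℓ j)).range (MvPolynomial σ ℂ ⧸ J)) :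
    ZariskiClosed ((fun x : σ → ℂ => fun j : Fin m => eval x (ℓ j)) '' VV J) := by
  set θ : MvPolynomial (Fin m) ℂ →ₐ[ℂ] (MvPolynomial σ ℂ ⧸ J) := 
    aeval (R := ℂ) fun j => Ideal.Quotient.mk J (ℓ j) with hθ
  have hθ2 : ∀ f, θ f = Ideal.Quotient.mk J (aeval ℓ f) := by
    intro f
    have : θ = (Ideal.Quotient.mkₐ ℂ J).comp (aeval ℓ) := by
      ext j; simp [hθ]
    rw [this]; rfl
  refine ⟨{f | θ f = 0}, ?_⟩
  ext y
  simp only [Set.mem_image, Set.mem_setOf_eq]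
  constructor
  · rintro ⟨x, hx, rfl⟩ f hf
    rw [hθ2, Ideal.Quotient.eq_zero_iff_mem] at hf
    have := hx _ hf
    rw [← this, ← aeval_eq_eval, ← aeval_eq_eval]
    exact (aeval_bind₁ ..).symm
  · intro hy
    let my : Ideal (MvPolynomial (Fin m) ℂ) := vanishingIdeal ℂ {y}
    have hmax : my.IsMaximal := isMaximal_iff_eq_vanishingIdeal_singleton.2 ⟨y, rfl⟩
    have hsurj : Function.Surjective θ.rangeRestrict := θ.rangeRestrict_surjective
    have hker : RingHom.ker θ.rangeRestrict ≤ my := by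
      intro f hf
      rw [mem_vanishingIdeal_singleton_iff, aeval_eq_eval]
      exact hy f (congrArg Subtype.val hf)
    have hcm : Ideal.comap θ.rangeRestrict (Ideal.map θ.rangeRestrict my) = my := by
      rw [Ideal.comap_map_of_surjective' _ hsurj, sup_eq_left.2 hker]
    have hPmax : (Ideal.map θ.rangeRestrict my).IsMaximal := by
      rcases Ideal.map_eq_top_or_isMaximal_of_surjective θ.rangeRestrict hsurj hmax with h | h
      · rw [h, Ideal.comap_top] at hcm
        exact absurd hcm.symm hmax.ne_top
      · exact h
    obtain ⟨Q, hQ, hQP⟩ := Ideal.exists_ideal_over_maximal_of_isIntegral (S := MvPolynomial σ ℂ ⧸ J) 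
      (Ideal.map θ.rangeRestrict my) (by
        rw [(RingHom.injective_iff_ker_eq_bot _).1]
        · exact bot_le
        · exact Subtype.val_injective)
    have hQ' : (Ideal.comap (Ideal.Quotient.mk J) Q).IsMaximal := 
      Ideal.comap_isMaximal_of_surjective _ Ideal.Quotient.mk_surjective
    obtain ⟨x, hx⟩ := isMaximal_iff_eq_vanishingIdeal_singleton.1 hQ'
    have hmem : ∀ f, f ∈ Ideal.comap (Ideal.Quotient.mk J) Q → eval x f = 0 := by
      intro f hf
      rw [hx, mem_vanishingIdeal_singleton_iff, aeval_eq_eval] at hf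
      exact hf
    refine ⟨x, fun f hf => hmem f ?_, ?_⟩
    · rw [Ideal.mem_comap, Ideal.Quotient.eq_zero_iff_mem.2 hf]; exact Q.zero_mem
    · funext j
      have h1 : (X j - C (y j) : MvPolynomial (Fin m) ℂ) ∈ my := by
        rw [mem_vanishingIdeal_singleton_iff]; simp
      have h2 := Ideal.mem_map_of_mem θ.rangeRestrict h1
      rw [← hQP, Ideal.mem_comap] at h2
      have h3 : algebraMap _ (MvPolynomial σ ℂ ⧸ J) (θ.rangeRestrict (X j - C (y j))) = 
          Ideal.Quotient.mk J (ℓ j - C (y j)) := by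
        have : algebraMap _ (MvPolynomial σ ℂ ⧸ J) (θ.rangeRestrict (X j - C (y j))) = θ (X j - C (y j)) := rfl
        rw [this, hθ2]
        simp [algebraMap_eq]
      rw [h3] at h2
      have := hmem _ h2
      rw [map_sub, eval_C, sub_eq_zero] at this
      exact this

lemma ellP_homog {t Δ : ℕ} (y : Fin t → ℂ) : (ellP (Δ := Δ) y).IsHomogeneous 1 := by
  unfold ellP
  refine IsHomogeneous.sum _ _ _ fun α _ => ?_
  have := (isHomogeneous_C (Fin t → Fin (Δ + 1)) (∏ i : Fin t, y i ^ (α i : ℕ))).mul (isHomogeneous_X ℂ α)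
  simpa using this

lemma zClosure_cone {σ : Type} (S : Set (σ → ℂ)) (hS : IsCone S) : IsCone (zClosure S) := by
  intro c v hv
  rw [mem_zClosure] at hv ⊢
  intro f hf
  have key : ∀ x : σ → ℂ, eval x (bind₁ (fun a => C c * X a) f) = eval (c • x) f := by
    intro x
    rw [← coe_aeval_eq_eval, ← coe_aeval_eq_eval]
    simp only [RingHom.coe_coe]
    rw [aeval_bind₁]
    congr 2
    funext α; simp
  rw [← key]
  refine hv _ fun x hx => ?_
  rw [key]
  exact hf _ (hS c x hx)

lemma closed_image_main {t Δ m : ℕ} (O : Set ((Fin t → Fin (Δ + 1)) → ℂ)) (hO : IsCone O)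
    (γ : Fin m → Fin t → ℂ) 
    (hinj : Set.InjOn (fun v => fun i : Fin m => evalVec v (γ i)) (zClosure O))
    (D : Set ((Fin t → Fin (Δ + 1)) → ℂ)) (hD : ZariskiClosed D) :
    ZariskiClosed ((fun v => fun i : Fin m => evalVec v (γ i)) '' (zClosure O ∩ D)) := by
  classical
  have hcone := zClosure_cone O hO
  have hcl : ∀ x, (∀ f, (∀ y ∈ zClosure O, eval y f = 0) → eval x f = 0) → x ∈ zClosure O := by
    intro x hx
    rw [mem_zClosure]
    intro f hf
    exact hx f fun y hy => (mem_zClosure _ _).1 hy f hf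
  have hrel := rel_exists (zClosure O) hcone hcl (fun j => ellP (γ j)) (fun j => ellP_homog _) (by
    intro x hx h
    have h0 : (0 : (Fin t → Fin (Δ + 1)) → ℂ) ∈ zClosure O := by
      have := hcone 0 x hx
      rwa [zero_smul] at this
    refine hinj hx h0 ?_
    funext j
    have := h j
    rw [eval_ellP] at this
    show evalVec x (γ j) = evalVec 0 (γ j)
    rw [this]
    simp [evalVec])
  choose n hn using hrel
  choose h hh hv using fun a => hn a (Finset.univ.sup n) (Finset.le_sup (Finset.mem_univ a))
  have hint := quot_integral (vanishingIdeal ℂ (zClosure O ∩ D)) (fun j => ellP (γ j)) _ h hh (by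
    intro a
    rw [mem_vanishingIdeal_iff]
    intro x hx
    rw [aeval_eq_eval]
    exact hv a x hx.1) (aeval (R := ℂ) fun j => Ideal.Quotient.mk _ (ellP (γ j))).range (by
    intro j
    exact ⟨X j, by simp⟩)
  have := image_closed _ _ hint
  have hVV : VV (vanishingIdeal ℂ (zClosure O ∩ D)) = zClosure O ∩ D := by
    ext x
    constructor
    · intro hx
      refine ⟨hcl x fun f hf => hx f ?_, ?_⟩
      · rw [mem_vanishingIdeal_iff]
        intro y hy
        exact hf y hy.1
      · obtain ⟨F, rfl⟩ := hD
        intro f hf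
        refine hx f ?_
        rw [mem_vanishingIdeal_iff]
        intro y hy
        exact hy.2 f hf
    · intro hx f hf
      exact mem_vanishingIdeal_iff.1 hf x hx
  rw [hVV] at this
  simpa only [eval_ellP] using this

lemma evalVec_add {t Δ : ℕ} (v w : (Fin t → Fin (Δ + 1)) → ℂ) (y) :
    evalVec (v + w) y = evalVec v y + evalVec w y := by
  unfold evalVec
  rw [← Finset.sum_add_distrib]
  refine Finset.sum_congr rfl fun α _ => ?_
  simp [add_mul]

end

/-- Encoding by values: for a holomorphically encoded `ℚ`-constructible object
class `O` of `t`-variate polynomials of degree at most `Δ` which is a cone,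
there is an identification sequence `γ ∈ (M^t)^m` (with `m ≥ 4L+2`) such that
the evaluation map `σ_γ(F) = (F(γ_1),…,F(γ_m))` is injective on `Ō`, is the
restriction of a `ℂ`-linear map, has Zariski closed conic image, and maps
`Ō ∩ C` (for `C` Zariski closed) onto Zariski closed sets, hence is a
homeomorphism of `Ō` onto `σ_γ(Ō)` for the Zariski topologies; moreover few
tuples `γ` fail to give an injective `σ_γ`. -/
theorem encoding_by_values_exists
    (t L K Δ Δ1 Δ2 m : ℕ)
    (ht : 1 ≤ t) (hL : 1 ≤ L) (hK : 1 ≤ K) (hΔ : 1 ≤ Δ) (hΔ2 : 1 ≤ Δ2)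
    (hm : 4 * L + 2 ≤ m)
    (G : Fin K → MvPolynomial (Fin L) ℚ) (hG : ∀ i, (G i).totalDegree ≤ Δ1)
    (D : Set (Fin L → ℂ))
    (hD : InBoolAlg
      (Set.range fun i : Fin K => {c : Fin L → ℂ | MvPolynomial.aeval c (G i) = 0}) D)
    (Ω : (Fin t → Fin (Δ + 1)) → MvPolynomial (Fin L) ℚ)
    (hΩdeg : ∀ α, (Ω α).totalDegree ≤ Δ2)
    (hΩsupp : ∀ α : Fin t → Fin (Δ + 1), Δ < ∑ i : Fin t, (α i : ℕ) → Ω α = 0)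
    (hcone : IsCone (objClass t L Δ D Ω))
    (M : Finset ℚ) (hM2 : 2 ≤ M.card)
    (hMbig : (Δ : ℝ) ^ 2 * ((L : ℝ) + 1) ^ ((1 : ℝ) / (L : ℝ)) *
        (1 + (K : ℝ) * (Δ1 : ℝ)) * (Δ2 : ℝ) ≤ (M.card : ℝ)) :
    (∃ γ : Fin m → Fin t → ℚ, (∀ i j, γ i j ∈ M) ∧
        Set.InjOn (fun v => fun i : Fin m => evalVec v (fun j => ((γ i j : ℚ) : ℂ)))
          (zClosure (objClass t L Δ D Ω)) ∧
        (∃ Λ : ((Fin t → Fin (Δ + 1)) → ℂ) →ₗ[ℂ] (Fin m → ℂ),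
          ∀ v ∈ zClosure (objClass t L Δ D Ω),
            (fun i : Fin m => evalVec v (fun j => ((γ i j : ℚ) : ℂ))) = Λ v) ∧
        ZariskiClosed
          ((fun v => fun i : Fin m => evalVec v (fun j => ((γ i j : ℚ) : ℂ))) ''
            zClosure (objClass t L Δ D Ω)) ∧
        IsCone
          ((fun v => fun i : Fin m => evalVec v (fun j => ((γ i j : ℚ) : ℂ))) ''
            zClosure (objClass t L Δ D Ω)) ∧
        ∀ C : Set ((Fin t → Fin (Δ + 1)) → ℂ), ZariskiClosed C →
          ZariskiClosed
            ((fun v => fun i : Fin m => evalVec v (fun j => ((γ i j : ℚ) : ℂ))) ''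
              (zClosure (objClass t L Δ D Ω) ∩ C))) ∧
      {γ : Fin m → Fin t → {x : ℚ // x ∈ M} |
          ¬ Set.InjOn (fun v => fun i : Fin m => evalVec v (fun j => ((γ i j : ℚ) : ℂ)))
              (zClosure (objClass t L Δ D Ω))}.ncard
        ≤ M.card ^ (m * t - 1) := by
  have hMN := M_big L K Δ Δ1 Δ2 M.card hL hΔ hΔ2 hMbig
  have hbad := bad_final (m := m) ht hΔ hΔ2 hm Ω hΩdeg hΩsupp M hMN
  have hsub : {γ : Fin m → Fin t → {x : ℚ // x ∈ M} |
          ¬ Set.InjOn (fun v => fun i : Fin m => evalVec v (fun j => ((γ i j : ℚ) : ℂ)))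
              (zClosure (objClass t L Δ D Ω))} ⊆ 
      (bad M (RingHom.ker (psiP Ω)) m : Set (Fin m → Fin t → {x : ℚ // x ∈ M})) := 
    fun γ hγ => notinj_bad D Ω M γ hγ
  have hcount := (Set.ncard_le_ncard hsub (Finset.finite_toSet _)).trans
    ((Set.ncard_coe_finset _).le.trans hbad)
  refine ⟨?_, hcount⟩
  have hmt : 1 ≤ m * t := Nat.mul_pos (by omega) ht
  obtain ⟨g, hg⟩ : ∃ γ : Fin m → Fin t → {x : ℚ // x ∈ M}, 
      Set.InjOn (fun v => fun i : Fin m => evalVec v (fun j => ((γ i j : ℚ) : ℂ)))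
              (zClosure (objClass t L Δ D Ω)) := by
    by_contra hcon
    push Not at hcon
    have huniv : {γ : Fin m → Fin t → {x : ℚ // x ∈ M} |
          ¬ Set.InjOn (fun v => fun i : Fin m => evalVec v (fun j => ((γ i j : ℚ) : ℂ)))
              (zClosure (objClass t L Δ D Ω))} = Set.univ := by
      ext γ; simp only [Set.mem_setOf_eq, Set.mem_univ, iff_true]; exact hcon γ
    rw [huniv, Set.ncard_univ, Nat.card_eq_fintype_card] at hcount
    simp only [Fintype.card_pi, Finset.prod_const, Finset.card_univ, Fintype.card_fin, 
      Fintype.card_coe, ← pow_mul] at hcount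
    have : M.card ^ (m * t - 1) < M.card ^ (m * t) := Nat.pow_lt_pow_right (by omega) (by omega)
    rw [mul_comm t m] at hcount
    omega
  have hclosed := closed_image_main (objClass t L Δ D Ω) hcone (fun i j => ((g i j : ℚ) : ℂ)) hg
  refine ⟨fun i j => (g i j : ℚ), fun i j => (g i j).2, hg, ?_, ?_, ?_, ?_⟩
  · exact ⟨{ toFun := fun v i => evalVec v (fun j => ((g i j : ℚ) : ℂ))
             map_add' := fun v w => funext fun i => evalVec_add v w _
             map_smul' := fun c v => funext fun i => evalVec_smul c v _ }, fun v _ => rfl⟩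
  · have := hclosed Set.univ ⟨∅, by simp⟩
    rwa [Set.inter_univ] at this
  · rintro c _ ⟨v, hv, rfl⟩
    exact ⟨c • v, zClosure_cone _ hcone c v hv, funext fun i => evalVec_smul c v _⟩
  · exact hclosed
end

section
/- Let t, L, m ≥ 1 be integers with m > L. Then there exists a set S ⊆ (ℝ^t)^m which is dense in the euclidean topology of (ℝ^t)^m and has the following property (universality): for every γ = (γ_1,…,γ_m) ∈ S, every ℚ-constructible set D ⊆ ℂ^L, every integer Δ ≥ 0 and every family (Ω_α)_{|α|≤Δ} of polynomials in ℚ[Z_1,…,Z_L] indexed by exponent vectors α ∈ ℕ^t with |α| ≤ Δ, setting Q_c := Σ_{|α|≤Δ} Ω_α(c)·Y^α and O := {Q_c : c ∈ D}, every polynomial F in the Zariski closure Ō of O (taken in the coefficient space of polynomials of total degree at most Δ in Y_1,…,Y_t) with F(γ_1) = ⋯ = F(γ_m) = 0 is the zero polynomial; that is, every γ ∈ S is a correct test sequence for the Zariski closure of every ℚ-constructible object class of t-variate polynomial functions admitting a ℚ-definable holomorphic encoding by a data structure of size L. -/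
open scoped BigOperators

theorem aux_dense (σ : Type) [Finite σ] :
    Dense {x : σ → ℝ | AlgebraicIndependent ℚ x} := by
  have key : {x : σ → ℝ | AlgebraicIndependent ℚ x} =
      ⋂ p : {p : MvPolynomial σ ℚ // p ≠ 0}, {x : σ → ℝ | MvPolynomial.aeval x p.1 ≠ 0} := by
    ext x
    simp only [Set.mem_ofPred_eq, Set.mem_iInter, algebraicIndependent_iff]
    constructor
    · intro h p hp
      exact p.2 (h p.1 hp)
    · intro h p hp
      by_contra hne
      exact h ⟨p, hne⟩ hp
  rw [key]
  have : Countable (MvPolynomial σ ℚ) := by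
    rw [← Cardinal.mk_le_aleph0_iff]
    refine (MvPolynomial.cardinalMk_le_max (σ := σ) (R := ℚ)).trans ?_
    simp
  cases nonempty_fintype σ
  have hcont : ∀ p : MvPolynomial σ ℚ, Continuous fun x : σ → ℝ => MvPolynomial.aeval x p := by
    intro p
    have : (fun x : σ → ℝ => MvPolynomial.aeval x p) =
        fun x => MvPolynomial.eval x (MvPolynomial.map (algebraMap ℚ ℝ) p) := by
      ext x
      rw [MvPolynomial.eval_map, MvPolynomial.aeval_def]
    rw [this]
    exact MvPolynomial.continuous_eval _
  apply dense_iInter_of_isOpen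
  · rintro ⟨p, hp⟩
    exact isOpen_ne_fun (hcont p) continuous_const
  · rintro ⟨p, hp⟩
    rw [dense_iff_inter_open]
    intro U hU ⟨x, hx⟩
    by_contra hne
    obtain ⟨I, hI, hIU⟩ := isOpen_pi_iff'.1 hU x hx
    apply hp
    have h0 : MvPolynomial.map (algebraMap ℚ ℝ) p = 0 := by
      apply MvPolynomial.funext_set I
      · intro i
        exact infinite_of_mem_nhds (x i) ((hI i).1.mem_nhds (hI i).2)
      · intro y hy
        by_contra h
        refine hne ⟨y, hIU hy, ?_⟩
        rw [MvPolynomial.eval_map] at h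
        simpa [MvPolynomial.aeval_def] using h
    exact MvPolynomial.map_injective _ (algebraMap ℚ ℝ).injective (by simpa using h0)

theorem aux_rel (t L Δ : ℕ) (D : Set (Fin L → ℂ))
    (Ω : (Fin t → Fin (Δ + 1)) → MvPolynomial (Fin L) ℚ)
    (v : (Fin t → Fin (Δ + 1)) → ℂ) (hv : v ∈ zClosure (objClass t L Δ D Ω))
    (f : MvPolynomial (Fin t → Fin (Δ + 1)) ℚ) (hf : MvPolynomial.aeval Ω f = 0) :
    MvPolynomial.aeval v f = 0 := by
  have := hv {x | MvPolynomial.aeval x f = 0} ⟨⟨{MvPolynomial.map (algebraMap ℚ ℂ) f}, ?_⟩, ?_⟩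
  · exact this
  · ext x
    simp [MvPolynomial.eval_map, MvPolynomial.aeval_def]
  · rintro w ⟨c, -, rfl⟩
    have h := congrArg (MvPolynomial.aeval c) hf
    rw [map_zero] at h
    rw [Set.mem_ofPred_eq, ← h, ← AlgHom.comp_apply, MvPolynomial.comp_aeval]

theorem aux_card (t L Δ : ℕ) (D : Set (Fin L → ℂ))
    (Ω : (Fin t → Fin (Δ + 1)) → MvPolynomial (Fin L) ℚ)
    (v : (Fin t → Fin (Δ + 1)) → ℂ) (hv : v ∈ zClosure (objClass t L Δ D Ω))
    (B : Set ℂ) (hB : AlgebraicIndepOn ℚ id B) (hBv : B ⊆ Set.range v) :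
    B.encard ≤ L := by
  choose s hs using fun b : B => hBv b.2
  have hind : AlgebraicIndependent ℚ (fun b : B => Ω (s b)) := by
    rw [algebraicIndependent_iff]
    intro p hp
    have h1 := aux_rel t L Δ D Ω v hv (MvPolynomial.rename s p)
      (by rw [MvPolynomial.aeval_rename]; exact hp)
    rw [MvPolynomial.aeval_rename] at h1
    refine (algebraicIndependent_iff.1 hB) p ?_
    rw [← h1]
    congr 2
    ext b
    simp [hs]
  have h := hind.cardinalMk_le_trdeg
  rw [MvPolynomial.trdeg_of_isDomain] at h
  simp at h
  have := Cardinal.toENat.monotone' h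
  simpa using this

theorem aux_row (m t L : ℕ) (hm : L < m) (x : Fin m → Fin t → ℂ)
    (hx : AlgebraicIndependent ℚ (fun p : Fin m × Fin t => x p.1 p.2))
    (B : Set ℂ) (hB : AlgebraicIndepOn ℚ id B) (hBL : B.encard ≤ L) :
    ∃ i, AlgebraicIndependent (Algebra.adjoin ℚ B) (x i) := by
  set M := AlgebraicIndependent.matroid ℚ ℂ with hM
  set G := Set.range (fun p : Fin m × Fin t => x p.1 p.2) with hG
  have hinj := hx.injective
  have hGi : M.Indep G := hx.to_subtype_range
  have hBi : M.Indep B := hB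
  obtain ⟨J, hJ, hBJ⟩ := hBi.subset_isBasis_of_subset (X := B ∪ G) Set.subset_union_left
    (by simp [hM])
  have hGc : G.encard = m * t := by
    rw [hG, ← Set.image_univ, hinj.encard_image, Set.encard_univ]
    simp
  have hcard : (m * t : ℕ∞) ≤ J.encard := by
    rw [hJ.encard_eq_eRk, ← hGc, ← hGi.eRk_eq_encard]
    exact M.eRk_mono Set.subset_union_right
  have hex : ∃ i, ∀ j, x i j ∈ J \ B := by
    by_contra hcon
    push Not at hcon
    choose j hj using hcon
    set N := Set.range (fun i => x i (j i)) with hN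
    have hNc : N.encard = m := by
      have : Function.Injective (fun i => x i (j i)) := by
        intro a b hab
        have := @hinj (a, j a) (b, j b) hab
        exact congrArg Prod.fst this
      rw [hN, ← Set.image_univ, this.encard_image, Set.encard_univ]
      simp
    have hd : Disjoint (J \ B) N := by
      rw [Set.disjoint_right]
      rintro _ ⟨i, rfl⟩
      exact hj i
    have hsub : (J \ B) ∪ N ⊆ G := by
      rintro y (hy | ⟨i, rfl⟩)
      · exact (hJ.subset hy.1).resolve_left hy.2
      · exact ⟨(i, j i), rfl⟩
    have h1 := Set.encard_le_encard hsub
    rw [Set.encard_union_eq hd, hNc, hGc] at h1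
    have h2 := Set.encard_sdiff_add_encard_of_subset hBJ
    have h3 : (m * t + m : ℕ∞) ≤ m * t + L := by
      calc (m * t + m : ℕ∞) ≤ J.encard + m := by gcongr
        _ = ((J \ B).encard + m) + B.encard := by rw [← h2]; ring
        _ ≤ m * t + L := by gcongr
    norm_cast at h3
    omega
  obtain ⟨i, hi⟩ := hex
  refine ⟨i, ?_⟩
  have hJi : AlgebraicIndepOn ℚ id J := hJ.indep
  let f : Fin t ⊕ B → J := Sum.elim (fun j => ⟨x i j, (hi j).1⟩) (fun b => ⟨b, hBJ b.2⟩)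
  have hf : Function.Injective f := by
    apply Function.Injective.sumElim
    · intro a b hab
      have := @hinj (i, a) (i, b) (congrArg Subtype.val hab)
      exact congrArg Prod.snd this
    · intro a b hab
      exact Subtype.ext (Subtype.mk.inj hab)
    · intro a b hab
      have h : x i a = b := congrArg Subtype.val hab
      exact (hi a).2 (h ▸ b.2)
  have h := hJi.comp f hf
  have h' : AlgebraicIndependent ℚ (Sum.elim (x i) (Subtype.val : B → ℂ)) := by
    convert h using 1
    ext (a | b) <;> rfl
  have := (AlgebraicIndependent.sumElim_iff.1 h').2
  rwa [Subtype.range_coe] at this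

theorem aux_zero {t Δ : ℕ} (S : Subalgebra ℚ ℂ) (v : (Fin t → Fin (Δ + 1)) → ℂ)
    (hv : ∀ α, IsAlgebraic S (v α)) (y : Fin t → ℂ) (hy : AlgebraicIndependent S y)
    (h0 : evalVec v y = 0) : v = 0 := by
  have hy' : AlgebraicIndependent (Subalgebra.algebraicClosure S ℂ) y :=
    AlgebraicIndependent.extendScalars (R := S) (S := Subalgebra.algebraicClosure S ℂ) hy
  let w : (Fin t → Fin (Δ + 1)) → Subalgebra.algebraicClosure S ℂ := fun α => ⟨v α, hv α⟩
  let e : (Fin t → Fin (Δ + 1)) → (Fin t →₀ ℕ) :=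
    fun α => Finsupp.equivFunOnFinite.symm (fun i => (α i : ℕ))
  have he : Function.Injective e := by
    intro a b hab
    have := Finsupp.equivFunOnFinite.symm.injective hab
    ext i
    exact congrFun this i
  have hP : (∑ α, MvPolynomial.monomial (e α) (w α)) = 0 := by
    apply algebraicIndependent_iff.1 hy'
    rw [map_sum, ← h0, evalVec]
    refine Finset.sum_congr rfl fun α _ => ?_
    rw [MvPolynomial.aeval_monomial, Finsupp.prod_fintype _ _ (by simp)]
    rfl
  ext α
  have := congrArg (MvPolynomial.coeff (e α)) hP
  rw [MvPolynomial.coeff_sum, Finset.sum_eq_single α] at this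
  · simp only [MvPolynomial.coeff_monomial, if_true, MvPolynomial.coeff_zero] at this
    exact congrArg Subtype.val this
  · intro b _ hb
    rw [MvPolynomial.coeff_monomial, if_neg (fun h => hb (he h))]
  · simp

/-- Universal correct test sequences: for `m > L` there is a dense set
`S ⊆ (ℝ^t)^m` each of whose elements is a correct test sequence for the Zariski
closure of every `ℚ`-constructible object class of `t`-variate polynomial
functions admitting a `ℚ`-definable holomorphic encoding by a data structure of
size `L`. -/
theorem universal_correct_test_sequences (t L m : ℕ)
    (ht : 1 ≤ t) (hL : 1 ≤ L) (hm : L < m) :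
    ∃ S : Set (Fin m → Fin t → ℝ), Dense S ∧
      ∀ γ ∈ S, ∀ D : Set (Fin L → ℂ),
        InBoolAlg
          {Z : Set (Fin L → ℂ) |
            ∃ g : MvPolynomial (Fin L) ℚ, Z = {c | MvPolynomial.aeval c g = 0}} D →
        ∀ (Δ : ℕ) (Ω : (Fin t → Fin (Δ + 1)) → MvPolynomial (Fin L) ℚ),
          (∀ α : Fin t → Fin (Δ + 1), Δ < ∑ i : Fin t, (α i : ℕ) → Ω α = 0) →
          ∀ v ∈ zClosure (objClass t L Δ D Ω),
            (∀ i : Fin m, evalVec v (fun j => ((γ i j : ℝ) : ℂ)) = 0) → v = 0 := by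
  refine ⟨{γ | AlgebraicIndependent ℚ (fun p : Fin m × Fin t => γ p.1 p.2)}, ?_, ?_⟩
  · have hd := aux_dense (Fin m × Fin t)
    let c : (Fin m × Fin t → ℝ) → (Fin m → Fin t → ℝ) := fun x i j => x (i, j)
    have hc : Continuous c := by fun_prop
    have hs : Function.Surjective c := fun γ => ⟨fun p => γ p.1 p.2, rfl⟩
    refine (hs.denseRange.dense_image hc hd).mono ?_
    rintro _ ⟨x, hx, rfl⟩
    exact hx
  · intro γ hγ D _ Δ Ω _ v hv h0
    have hx : AlgebraicIndependent ℚ (fun p : Fin m × Fin t => ((γ p.1 p.2 : ℝ) : ℂ)) :=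
      AlgebraicIndependent.map' (f := (Algebra.ofId ℝ ℂ).restrictScalars ℚ) hγ
        Complex.ofReal_injective
    obtain ⟨B, hB⟩ := (AlgebraicIndependent.matroid ℚ ℂ).exists_isBasis (Set.range v) (by simp)
    have hBi : AlgebraicIndepOn ℚ id B := hB.indep
    obtain ⟨i, hi⟩ := aux_row m t L hm (fun i j => ((γ i j : ℝ) : ℂ)) hx B hBi
      (aux_card t L Δ D Ω v hv B hBi hB.subset)
    refine aux_zero _ v (fun α => ?_) _ hi (h0 i)
    exact (AlgebraicIndependent.matroid_isBasis_iff.1 hB).2.2 _ ⟨α, rfl⟩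
end
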